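/- arXiv:2302.06128 — 5 statements merged into one kernel-verified Lean document; each statement's English description precedes it below -/
import Mathlib

section
/- Let y₁ be a solution of equation (2.1) on [t₀, τ₀), and let η : [t₀, τ₀) → ℝ be differentiable with η′(t) + a(t)η(t)³ + b(t)η(t)² + c(t)η(t) + d(t) ≥ 0 for all t ∈ [t₀, τ₀) and η(t₀) ≥ y₁(t₀). Assume: (I) a(t) < 0 for almost every t ∈ [t₀, τ₀) and b²/a is locally integrable on [t₀, τ₀); (II) there exists γ ∈ [y₁(t₀), η(t₀)] such that for all t ∈ [t₀, τ₀), γ − y₁(t₀) + ∫_{t₀}^{t} exp(∫_{t₀}^{τ} [c(s) − b(s)²/a(s)] ds)·[(a₁(τ) − a(τ))y₁(τ)³ + (b₁(τ) − b(τ))y₁(τ)² + (c₁(τ) − c(τ))y₁(τ) + d₁(τ) − d(τ)] dτ ≥ 0. Then every noncontinuable solution y of (1.1) with y(t₀) ∈ [γ, η(t₀)] is defined on all of [t₀, τ₀) and satisfies y₁(t) ≤ y(t) ≤ η(t) for all t ∈ [t₀, τ₀). Furthermore, if y₁(t₀) < y(t₀) then y₁(t) < y(t) on [t₀, τ₀),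 and if y(t₀) < η(t₀) then y(t) < η(t) on [t₀, τ₀). -/
open Set MeasureTheory intervalIntegral

/-- The right-hand side `-(a y³ + b y² + c y + d)` of the Abel equation (1.1). -/
noncomputable def abelRHS (a b c d y : ℝ → ℝ) (t : ℝ) : ℝ :=
  -(a t * y t ^ 3 + b t * y t ^ 2 + c t * y t + d t)

/-- `y` is a solution of the Abel equation `y' + a y³ + b y² + c y + d = 0` on the set `S`. -/
def IsAbelSolOn (a b c d y : ℝ → ℝ) (S : Set ℝ) : Prop :=
  ∀ t ∈ S, HasDerivWithinAt y (abelRHS a b c d y t) S t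

/-- The set of real points of the interval `[t₀, τ)`, `τ` an extended real. -/
def eIco (t₀ : ℝ) (τ : EReal) : Set ℝ := {t : ℝ | t₀ ≤ t ∧ (t : EReal) < τ}

/-- A solution `y` of the Abel equation on `[t₀, t₁) ⊆ [t₀, τ₀)` is noncontinuable if it
cannot be extended to the right as a solution on a larger subinterval of `[t₀, τ₀)`. -/
def Noncontinuable (a b c d : ℝ → ℝ) (t₀ : ℝ) (τ₀ t₁ : EReal) (y : ℝ → ℝ) : Prop :=
  ¬ ∃ (t₂ : EReal) (z : ℝ → ℝ), t₁ < t₂ ∧ t₂ ≤ τ₀ ∧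
      IsAbelSolOn a b c d z (eIco t₀ t₂) ∧ EqOn z y (eIco t₀ t₁)

theorem ac_comp_lip {f g : ℝ → ℝ} {a b : ℝ} {K : NNReal} {s : Set ℝ}
    (hf : AbsolutelyContinuousOnInterval f a b) (hg : LipschitzOnWith K g s)
    (hm : MapsTo f (uIcc a b) s) :
    AbsolutelyContinuousOnInterval (fun x => g (f x)) a b := by
  rw [absolutelyContinuousOnInterval_iff] at hf ⊢
  intro ε hε
  obtain ⟨δ, hδ, h⟩ := hf (ε / (K + 1)) (by positivity)
  refine ⟨δ, hδ, fun E hE hl => ?_⟩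
  have h1 := h E hE hl
  have h2 : ∑ i ∈ Finset.range E.1, dist (g (f (E.2 i).1)) (g (f (E.2 i).2)) ≤
      ∑ i ∈ Finset.range E.1, K * dist (f (E.2 i).1) (f (E.2 i).2) := by
    refine Finset.sum_le_sum fun i hi => ?_
    exact hg.dist_le_mul _ (hm (hE.1 i hi).1) _ (hm (hE.1 i hi).2)
  rw [← Finset.mul_sum] at h2
  rw [lt_div_iff₀ (by positivity)] at h1
  have h3 : 0 ≤ ∑ i ∈ Finset.range E.1, dist (f (E.2 i).1) (f (E.2 i).2) :=
    Finset.sum_nonneg fun _ _ => dist_nonneg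
  have : (0:ℝ) ≤ K := K.2
  nlinarith

theorem ac_exp {f : ℝ → ℝ} {a b : ℝ}
    (hf : AbsolutelyContinuousOnInterval f a b) :
    AbsolutelyContinuousOnInterval (fun x => Real.exp (f x)) a b := by
  obtain ⟨C, hC⟩ := hf.exists_bound
  have h1 : ContDiffOn ℝ 1 Real.exp (Icc (-C) C) := Real.contDiff_exp.contDiffOn
  obtain ⟨K, hK⟩ := h1.exists_lipschitzOnWith (by decide) (convex_Icc _ _) isCompact_Icc
  exact ac_comp_lip hf hK (fun x hx => abs_le.1 (hC x hx))

theorem hasDerivAt_int {f : ℝ → ℝ} {a b t : ℝ} (hf : ContinuousOn f (Icc a b))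
    (ht : t ∈ Ioo a b) : HasDerivAt (fun x => ∫ s in a..x, f s) (f t) t := by
  have hab : a ≤ b := ht.1.le.trans ht.2.le
  refine integral_hasDerivAt_right ?_ ?_ (hf.continuousAt (Icc_mem_nhds ht.1 ht.2))
  · refine ContinuousOn.intervalIntegrable ?_
    rw [uIcc_of_le ht.1.le]
    exact hf.mono (Icc_subset_Icc_right ht.2.le)
  · exact (hf.mono Ioo_subset_Icc_self).stronglyMeasurableAtFilter isOpen_Ioo t ht

theorem core_id {t₀ T : ℝ} (hT : t₀ < T) {G H F w : ℝ → ℝ}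
    (hG : ContinuousOn G (Icc t₀ T)) (hF : ContinuousOn F (Icc t₀ T))
    (hH : IntervalIntegrable H volume t₀ T)
    (hw : ContinuousOn w (Icc t₀ T))
    (hw' : ∀ t ∈ Ioo t₀ T, HasDerivAt w (F t - G t * w t) t) :
    IntervalIntegrable (fun t => (H t - G t) * (Real.exp (-∫ s in t₀..t, (H s - G s)) *
        (w t₀ + ∫ τ in t₀..t, Real.exp (∫ s in t₀..τ, H s) * F τ))) volume t₀ T ∧
    w T * Real.exp (∫ s in t₀..T, G s) =
      Real.exp (-∫ s in t₀..T, (H s - G s)) *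
        (w t₀ + ∫ τ in t₀..T, Real.exp (∫ s in t₀..τ, H s) * F τ) +
      ∫ t in t₀..T, (H t - G t) * (Real.exp (-∫ s in t₀..t, (H s - G s)) *
        (w t₀ + ∫ τ in t₀..t, Real.exp (∫ s in t₀..τ, H s) * F τ)) := by
  have huI : uIcc t₀ T = Icc t₀ T := uIcc_of_le hT.le
  have hGi : IntervalIntegrable G volume t₀ T :=
    ContinuousOn.intervalIntegrable (by rwa [huI])
  have hp : IntervalIntegrable (fun s => H s - G s) volume t₀ T := hH.sub hGi
  have hE : AbsolutelyContinuousOnInterval (fun τ => Real.exp (∫ s in t₀..τ, H s)) t₀ T :=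
    ac_exp (hH.absolutelyContinuousOnInterval_intervalIntegral left_mem_uIcc)
  have hEc : ContinuousOn (fun τ => Real.exp (∫ s in t₀..τ, H s)) (Icc t₀ T) := by
    rw [← huI]; exact hE.continuousOn
  have hEF : ContinuousOn (fun τ => Real.exp (∫ s in t₀..τ, H s) * F τ) (Icc t₀ T) := hEc.mul hF
  have hEFi : IntervalIntegrable (fun τ => Real.exp (∫ s in t₀..τ, H s) * F τ) volume t₀ T :=
    ContinuousOn.intervalIntegrable (by rwa [huI])
  set R : ℝ → ℝ := fun t => Real.exp (-∫ s in t₀..t, (H s - G s)) with hRdef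
  set Φ : ℝ → ℝ := fun t => w t₀ + ∫ τ in t₀..t, Real.exp (∫ s in t₀..τ, H s) * F τ with hΦdef
  have hPac := hp.absolutelyContinuousOnInterval_intervalIntegral (c := t₀) left_mem_uIcc
  have hR : AbsolutelyContinuousOnInterval R t₀ T := ac_exp hPac.neg
  have hΦ : AbsolutelyContinuousOnInterval Φ t₀ T := by
    have h1 : AbsolutelyContinuousOnInterval (fun _ : ℝ => w t₀) t₀ T :=
      (LipschitzWith.const (w t₀)).lipschitzOnWith.absolutelyContinuousOnInterval
    exact h1.add (hEFi.absolutelyContinuousOnInterval_intervalIntegral (c := t₀) left_mem_uIcc)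
  have hne : ∀ᵐ t : ℝ, t ≠ T := by simp [ae_iff, measure_singleton]
  have hR' : ∀ᵐ t, t ∈ uIoc t₀ T → deriv R t * Φ t = -((H t - G t) * (R t * Φ t)) := by
    filter_upwards [hp.ae_hasDerivAt_integral] with t ht htm
    have h1 := (ht (uIoc_subset_uIcc htm) t₀ left_mem_uIcc).neg.exp
    have h2 : deriv R t = R t * -(H t - G t) := h1.deriv
    rw [h2]; ring
  have hΦ' : ∀ᵐ t, t ∈ uIoc t₀ T →
      R t * deriv Φ t = Real.exp (∫ s in t₀..t, G s) * F t := by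
    filter_upwards [hne] with t htT htm
    rw [uIoc_of_le hT.le] at htm
    have hto : t ∈ Ioo t₀ T := ⟨htm.1, lt_of_le_of_ne htm.2 htT⟩
    have h1 := ((hasDerivAt_int hEF hto).const_add (w t₀)).deriv
    have h2 : deriv Φ t = _ := h1
    rw [h2]
    simp only [hRdef]
    have hsub : uIcc t₀ t ⊆ uIcc t₀ T := by
      rw [uIcc_of_le htm.1.le, huI]; exact Icc_subset_Icc_right htm.2
    rw [integral_sub (hH.mono_set hsub) (hGi.mono_set hsub), ← mul_assoc, ← Real.exp_add]
    congr 2; ring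
  have hparts := hR.integral_mul_deriv_eq_deriv_mul hΦ
  rw [integral_congr_ae hΦ', integral_congr_ae hR', intervalIntegral.integral_neg] at hparts
  -- the fundamental theorem for w exp(∫ G)
  have hIG : ContinuousOn (fun t => ∫ s in t₀..t, G s) (Icc t₀ T) := by
    rw [← huI]
    exact (hGi.absolutelyContinuousOnInterval_intervalIntegral (c := t₀) left_mem_uIcc).continuousOn
  have hft := integral_eq_sub_of_hasDerivAt_of_le (a := t₀) (b := T)
    (f := fun t => w t * Real.exp (∫ s in t₀..t, G s))
    (f' := fun t => Real.exp (∫ s in t₀..t, G s) * F t) hT.le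
    (hw.mul hIG.rexp) (fun t ht => by
      convert! (hw' t ht).mul (hasDerivAt_int hG ht).exp using 1
      ring)
    (ContinuousOn.intervalIntegrable (by rw [huI]; exact hIG.rexp.mul hF))
  refine ⟨?_, ?_⟩
  · exact hp.mul_continuousOn (hR.continuousOn.mul hΦ.continuousOn)
  · rw [hft] at hparts
    have e1 : R t₀ = 1 := by simp [hRdef]
    have e2 : Φ t₀ = w t₀ := by simp [hΦdef]
    simp only [e1, e2, integral_same, Real.exp_zero] at hparts
    linarith

theorem core_lower {t₀ T : ℝ} (hT : t₀ < T) {G H F w : ℝ → ℝ}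
    (hG : ContinuousOn G (Icc t₀ T)) (hF : ContinuousOn F (Icc t₀ T))
    (hH : IntervalIntegrable H volume t₀ T)
    (hw : ContinuousOn w (Icc t₀ T))
    (hw' : ∀ t ∈ Ioo t₀ T, HasDerivAt w (F t - G t * w t) t)
    (hGH : ∀ᵐ t, t ∈ Ioc t₀ T → G t ≤ H t ∧ (0 < w t → G t < H t))
    (hΦ : ∀ t ∈ Icc t₀ T, 0 ≤ w t₀ + ∫ τ in t₀..t, Real.exp (∫ s in t₀..τ, H s) * F τ) :
    0 ≤ w T ∧ (0 < w t₀ → 0 < w T) := by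
  obtain ⟨hi, hid⟩ := core_id hT hG hF hH hw hw'
  set Φ : ℝ → ℝ := fun t => w t₀ + ∫ τ in t₀..t, Real.exp (∫ s in t₀..τ, H s) * F τ with hΦdef
  have h0 : 0 ≤ᵐ[volume.restrict (uIoc t₀ T)]
      (fun t => (H t - G t) * (Real.exp (-∫ s in t₀..t, (H s - G s)) * Φ t)) := by
    rw [Filter.EventuallyLE, ae_restrict_iff' measurableSet_uIoc, uIoc_of_le hT.le]
    filter_upwards [hGH] with t ht htm
    exact mul_nonneg (sub_nonneg.2 (ht htm).1) (mul_nonneg (Real.exp_pos _).le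
      (hΦ t (Ioc_subset_Icc_self htm)))
  have hfirst : 0 ≤ Real.exp (-∫ s in t₀..T, (H s - G s)) * Φ T :=
    mul_nonneg (Real.exp_pos _).le (hΦ T (right_mem_Icc.2 hT.le))
  have hpos := Real.exp_pos (∫ s in t₀..T, G s)
  constructor
  · have h1 : 0 ≤ ∫ t in t₀..T,
        (H t - G t) * (Real.exp (-∫ s in t₀..t, (H s - G s)) * Φ t) := by
      rw [integral_of_le hT.le, ← uIoc_of_le hT.le]
      exact MeasureTheory.integral_nonneg_of_ae h0
    by_contra hc
    have := mul_neg_of_neg_of_pos (not_le.1 hc) hpos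
    change w T * _ = _ * Φ T + ∫ t in t₀..T, (H t - G t) * (Real.exp (-∫ s in t₀..t, (H s - G s)) * Φ t) at hid
    linarith
  · intro hw0
    have huI : uIcc t₀ T = Icc t₀ T := uIcc_of_le hT.le
    have hEc : ContinuousOn (fun τ => Real.exp (∫ s in t₀..τ, H s)) (Icc t₀ T) := by
      rw [← huI]
      exact (ac_exp (hH.absolutelyContinuousOnInterval_intervalIntegral left_mem_uIcc)).continuousOn
    have hEFi : IntervalIntegrable (fun τ => Real.exp (∫ s in t₀..τ, H s) * F τ) volume t₀ T :=
      ContinuousOn.intervalIntegrable (by rw [huI]; exact hEc.mul hF)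
    have hΦc : ContinuousOn Φ (Icc t₀ T) := by
      rw [← huI]
      exact continuousOn_const.add
       (hEFi.absolutelyContinuousOnInterval_intervalIntegral (c := t₀) left_mem_uIcc).continuousOn
    have hmem : t₀ ∈ Icc t₀ T := left_mem_Icc.2 hT.le
    have hΦ0 : 0 < Φ t₀ := by simpa [hΦdef] using hw0
    have ev : ∀ᶠ t in nhdsWithin t₀ (Icc t₀ T), 0 < w t ∧ 0 < Φ t :=
      ((hw t₀ hmem).eventually (lt_mem_nhds hw0)).and ((hΦc t₀ hmem).eventually (lt_mem_nhds hΦ0))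
    rw [nhdsWithin_Icc_eq_nhdsGE hT] at ev
    obtain ⟨u, hu, hsub⟩ := mem_nhdsGE_iff_exists_Ico_subset.1 ev
    have hu' : t₀ < min u T := lt_min hu hT
    have hpi : 0 < ∫ t in t₀..T,
        (H t - G t) * (Real.exp (-∫ s in t₀..t, (H s - G s)) * Φ t) := by
      rw [integral_pos_iff_support_of_nonneg_ae' h0 hi]
      refine ⟨hT, ((Measure.measure_Ioo_pos volume).mpr hu').trans_le (measure_mono_ae ?_)⟩
      filter_upwards [hGH] with t ht htm
      have htm' : t ∈ Ioo t₀ (min u T) := htm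
      have htI : t ∈ Ioc t₀ T := ⟨htm'.1, (htm'.2.trans_le (min_le_right _ _)).le⟩
      have h3 := hsub ⟨htm'.1.le, htm'.2.trans_le (min_le_left _ _)⟩
      refine ⟨?_, htI⟩
      exact (mul_pos (sub_pos.2 ((ht htI).2 h3.1)) (mul_pos (Real.exp_pos _) h3.2)).ne'
    by_contra hc
    have := mul_nonpos_of_nonpos_of_nonneg (not_lt.1 hc) hpos.le
    change w T * _ = _ * Φ T + ∫ t in t₀..T, (H t - G t) * (Real.exp (-∫ s in t₀..t, (H s - G s)) * Φ t) at hid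
    linarith

theorem core_upper {t₀ T : ℝ} (hT : t₀ < T) {G m : ℝ → ℝ}
    (hG : ContinuousOn G (Icc t₀ T)) (hm : ContinuousOn m (Icc t₀ T))
    (hm' : ∀ t ∈ Ioo t₀ T, ∃ v, HasDerivAt m v t ∧ 0 ≤ v + G t * m t) :
    m t₀ ≤ m T * Real.exp (∫ s in t₀..T, G s) := by
  have huI : uIcc t₀ T = Icc t₀ T := uIcc_of_le hT.le
  have hGi : IntervalIntegrable G volume t₀ T :=
    ContinuousOn.intervalIntegrable (by rwa [huI])
  have hIG : ContinuousOn (fun t => ∫ s in t₀..t, G s) (Icc t₀ T) := by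
    rw [← huI]
    exact (hGi.absolutelyContinuousOnInterval_intervalIntegral (c := t₀) left_mem_uIcc).continuousOn
  have key : ∀ t ∈ Ioo t₀ T, ∃ v, HasDerivAt (fun t => m t * Real.exp (∫ s in t₀..t, G s)) v t
      ∧ 0 ≤ v := by
    intro t ht
    obtain ⟨v, hv, hv0⟩ := hm' t ht
    refine ⟨_, hv.mul (hasDerivAt_int hG ht).exp, ?_⟩
    have := mul_nonneg hv0 (Real.exp_pos (∫ s in t₀..t, G s)).le
    linarith
  have hmono : MonotoneOn (fun t => m t * Real.exp (∫ s in t₀..t, G s)) (Icc t₀ T) := by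
    refine monotoneOn_of_deriv_nonneg (convex_Icc _ _) (hm.mul hIG.rexp) ?_ ?_
    · rw [interior_Icc]
      intro t ht
      obtain ⟨v, hv, -⟩ := key t ht
      exact hv.differentiableAt.differentiableWithinAt
    · rw [interior_Icc]
      intro t ht
      obtain ⟨v, hv, h0⟩ := key t ht
      rwa [hv.deriv]
  have := hmono (left_mem_Icc.2 hT.le) (right_mem_Icc.2 hT.le) hT.le
  simpa using this

theorem poly_bound {a b c d x A B C D M : ℝ} (ha : |a| ≤ A) (hb : |b| ≤ B) (hc : |c| ≤ C)
    (hd : |d| ≤ D) (hx : |x| ≤ M) :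
    |-(a * x ^ 3 + b * x ^ 2 + c * x + d)| ≤ A * M ^ 3 + B * M ^ 2 + C * M + D := by
  have hA := (abs_nonneg a).trans ha
  have hB := (abs_nonneg b).trans hb
  have hC := (abs_nonneg c).trans hc
  rw [abs_neg]
  have h1 : |a * x ^ 3| ≤ A * M ^ 3 := by rw [abs_mul, abs_pow]; gcongr
  have h2 : |b * x ^ 2| ≤ B * M ^ 2 := by rw [abs_mul, abs_pow]; gcongr
  have h3 : |c * x| ≤ C * M := by rw [abs_mul]; gcongr
  have h4 := abs_add_le (a * x ^ 3 + b * x ^ 2 + c * x) d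
  have h5 := abs_add_le (a * x ^ 3 + b * x ^ 2) (c * x)
  have h6 := abs_add_le (a * x ^ 3) (b * x ^ 2)
  linarith

theorem poly_lip {a b c d x z A B C M : ℝ} (ha : |a| ≤ A) (hb : |b| ≤ B) (hc : |c| ≤ C)
    (hx : |x| ≤ M) (hz : |z| ≤ M) :
    |-(a * x ^ 3 + b * x ^ 2 + c * x + d) - -(a * z ^ 3 + b * z ^ 2 + c * z + d)| ≤
      (A * (3 * M ^ 2) + B * (2 * M) + C) * |x - z| := by
  have hA := (abs_nonneg a).trans ha
  have hB := (abs_nonneg b).trans hb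
  have hM := (abs_nonneg x).trans hx
  have e : -(a * x ^ 3 + b * x ^ 2 + c * x + d) - -(a * z ^ 3 + b * z ^ 2 + c * z + d)
      = -((a * (x ^ 2 + x * z + z ^ 2) + b * (x + z) + c) * (x - z)) := by ring
  rw [e, abs_neg, abs_mul]
  gcongr
  have q1 : |x ^ 2 + x * z + z ^ 2| ≤ 3 * M ^ 2 := by
    have h1 : |x ^ 2| ≤ M ^ 2 := by rw [abs_pow]; gcongr
    have h2 : |z ^ 2| ≤ M ^ 2 := by rw [abs_pow]; gcongr
    have h3 : |x * z| ≤ M * M := by rw [abs_mul]; gcongr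
    have h4 := abs_add_le (x ^ 2 + x * z) (z ^ 2)
    have h5 := abs_add_le (x ^ 2) (x * z)
    nlinarith
  have q2 : |x + z| ≤ 2 * M := by
    have := abs_add_le x z
    linarith
  have h1 : |a * (x ^ 2 + x * z + z ^ 2)| ≤ A * (3 * M ^ 2) := by rw [abs_mul]; gcongr
  have h2 : |b * (x + z)| ≤ B * (2 * M) := by rw [abs_mul]; gcongr
  have h4 := abs_add_le (a * (x ^ 2 + x * z + z ^ 2) + b * (x + z)) c
  have h5 := abs_add_le (a * (x ^ 2 + x * z + z ^ 2)) (b * (x + z))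
  linarith

theorem eIco_coe (t₀ T : ℝ) : eIco t₀ (T : EReal) = Ico t₀ T := by
  ext t; simp [eIco]

theorem picard_ext {T S : ℝ} (hTS : T < S) {a b c d : ℝ → ℝ}
    (ha : ContinuousOn a (Icc T S)) (hb : ContinuousOn b (Icc T S))
    (hc : ContinuousOn c (Icc T S)) (hd : ContinuousOn d (Icc T S)) (L : ℝ) :
    ∃ (U : ℝ) (α : ℝ → ℝ), T < U ∧ U ≤ S ∧ α T = L ∧
      ∀ t ∈ Icc T U, HasDerivWithinAt α (abelRHS a b c d α t) (Icc T U) t := by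
  obtain ⟨A, hA⟩ := isCompact_Icc.exists_bound_of_continuousOn ha
  obtain ⟨B, hB⟩ := isCompact_Icc.exists_bound_of_continuousOn hb
  obtain ⟨C, hC⟩ := isCompact_Icc.exists_bound_of_continuousOn hc
  obtain ⟨D, hD⟩ := isCompact_Icc.exists_bound_of_continuousOn hd
  simp only [Real.norm_eq_abs] at hA hB hC hD
  have hTm : T ∈ Icc T S := left_mem_Icc.2 hTS.le
  have hA0 := (abs_nonneg _).trans (hA T hTm)
  have hB0 := (abs_nonneg _).trans (hB T hTm)
  have hC0 := (abs_nonneg _).trans (hC T hTm)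
  have hD0 := (abs_nonneg _).trans (hD T hTm)
  set M := |L| + 1 with hM
  have hM0 : 0 ≤ M := by positivity
  set Q := A * M ^ 3 + B * M ^ 2 + C * M + D with hQ
  have hQ0 : 0 ≤ Q := by positivity
  set K := A * (3 * M ^ 2) + B * (2 * M) + C with hK
  have hK0 : 0 ≤ K := by positivity
  set U := min S (T + 1 / (Q + 1)) with hU
  have hTU : T < U := lt_min hTS (by have : 0 < 1 / (Q + 1) := by positivity
                                     linarith)
  have hUS : U ≤ S := min_le_left _ _
  have hsub : Icc T U ⊆ Icc T S := Icc_subset_Icc_right hUS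
  have hball : ∀ x ∈ Metric.closedBall L ((1 : NNReal) : ℝ), |x| ≤ M := by
    intro x hx
    rw [Metric.mem_closedBall, Real.dist_eq] at hx
    have := abs_add_le (x - L) L
    simp at hx this
    linarith
  have hpl : IsPicardLindelof (fun t x => -(a t * x ^ 3 + b t * x ^ 2 + c t * x + d t))
      (tmin := T) (tmax := U) ⟨T, left_mem_Icc.2 hTU.le⟩ L 1 0 ⟨Q, hQ0⟩ ⟨K, hK0⟩ := by
    refine ⟨?_, ?_, ?_, ?_⟩
    · intro t ht
      refine LipschitzOnWith.of_dist_le_mul fun x hx z hz => ?_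
      rw [Real.dist_eq, Real.dist_eq]
      exact poly_lip (hA t (hsub ht)) (hB t (hsub ht)) (hC t (hsub ht)) (hball x hx) (hball z hz)
    · intro x _
      have := ha.mono hsub
      have := hb.mono hsub
      have := hc.mono hsub
      have := hd.mono hsub
      fun_prop
    · intro t ht x hx
      rw [Real.norm_eq_abs]
      exact poly_bound (hA t (hsub ht)) (hB t (hsub ht)) (hC t (hsub ht)) (hD t (hsub ht))
        (hball x hx)
    · have h1 : U - T ≤ 1 / (Q + 1) := by
        have := min_le_right S (T + 1 / (Q + 1))
        linarith
      have h2 : max (U - T) (T - T) = U - T := max_eq_left (by linarith)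
      change Q * max (U - T) (T - T) ≤ _
      rw [h2]
      simp only [NNReal.coe_one, NNReal.coe_zero, sub_zero]
      calc Q * (U - T) ≤ Q * (1 / (Q + 1)) := by gcongr
        _ ≤ 1 := by rw [mul_one_div, div_le_one (by positivity)]; linarith
  obtain ⟨α, h1, h2⟩ := hpl.exists_eq_forall_mem_Icc_hasDerivWithinAt₀
  exact ⟨U, α, hTU, hUS, h1, h2⟩

theorem abel_extend {t₀ T : ℝ} {τ₀ : EReal} (hT : t₀ < T) (hTτ : (T : EReal) < τ₀)
    {a b c d y : ℝ → ℝ}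
    (ha : ContinuousOn a (eIco t₀ τ₀)) (hb : ContinuousOn b (eIco t₀ τ₀))
    (hc : ContinuousOn c (eIco t₀ τ₀)) (hd : ContinuousOn d (eIco t₀ τ₀))
    (hy : IsAbelSolOn a b c d y (Ico t₀ T)) (M : ℝ) (hM : ∀ t ∈ Ico t₀ T, |y t| ≤ M) :
    ∃ (t₂ : EReal) (z : ℝ → ℝ), (T : EReal) < t₂ ∧ t₂ ≤ τ₀ ∧
      IsAbelSolOn a b c d z (eIco t₀ t₂) ∧ EqOn z y (Ico t₀ T) := by
  obtain ⟨S, hTS, hSτ⟩ := EReal.lt_iff_exists_real_btwn.1 hTτ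
  rw [EReal.coe_lt_coe_iff] at hTS
  have hsub : Icc t₀ S ⊆ eIco t₀ τ₀ := fun t ht =>
    ⟨ht.1, lt_of_le_of_lt (EReal.coe_le_coe_iff.2 ht.2) hSτ⟩
  replace ha := ha.mono hsub
  replace hb := hb.mono hsub
  replace hc := hc.mono hsub
  replace hd := hd.mono hsub
  obtain ⟨A, hA⟩ := isCompact_Icc.exists_bound_of_continuousOn ha
  obtain ⟨B, hB⟩ := isCompact_Icc.exists_bound_of_continuousOn hb
  obtain ⟨C, hC⟩ := isCompact_Icc.exists_bound_of_continuousOn hc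
  obtain ⟨D, hD⟩ := isCompact_Icc.exists_bound_of_continuousOn hd
  simp only [Real.norm_eq_abs] at hA hB hC hD
  have hIS : Ico t₀ T ⊆ Icc t₀ S := fun t ht => ⟨ht.1, ht.2.le.trans hTS.le⟩
  have hbd : ∀ t ∈ Ico t₀ T, |abelRHS a b c d y t| ≤ A * M ^ 3 + B * M ^ 2 + C * M + D :=
    fun t ht => poly_bound (hA t (hIS ht)) (hB t (hIS ht)) (hC t (hIS ht)) (hD t (hIS ht)) (hM t ht)
  have hQ0 : 0 ≤ A * M ^ 3 + B * M ^ 2 + C * M + D :=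
    (abs_nonneg _).trans (hbd t₀ ⟨le_rfl, hT⟩)
  have hlip : LipschitzOnWith ⟨_, hQ0⟩ y (Ico t₀ T) :=
    (convex_Ico t₀ T).lipschitzOnWith_of_nnnorm_hasDerivWithin_le (fun t ht => hy t ht)
      (fun t ht => NNReal.coe_le_coe.1 (hbd t ht))
  obtain ⟨z₀, hz₀, hyz⟩ := hlip.extend_real
  have hz₀c : Continuous z₀ := hz₀.continuous
  have hTm : T ∈ Ioo t₀ S := ⟨hT, hTS⟩
  have hnT : Icc t₀ S ∈ nhds T := Icc_mem_nhds hT hTS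
  have hz₀d : ∀ t ∈ Ioo t₀ T, HasDerivAt z₀ (abelRHS a b c d z₀ t) t := by
    intro t ht
    have htI : t ∈ Ico t₀ T := ⟨ht.1.le, ht.2⟩
    have h1 := (hy t htI).congr (fun s hs => (hyz hs).symm) (hyz htI).symm
    have h2 : abelRHS a b c d y t = abelRHS a b c d z₀ t := by
      simp only [abelRHS, hyz htI]
    rw [h2] at h1
    exact h1.hasDerivAt (Ico_mem_nhds ht.1 ht.2)
  have hleft : HasDerivWithinAt z₀ (abelRHS a b c d z₀ T) (Iic T) T := by
    have hIoo : Ioo t₀ T ∈ nhdsWithin T (Iio T) := Ioo_mem_nhdsLT hT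
    refine hasDerivWithinAt_Iic_of_tendsto_deriv (s := Ioo t₀ T)
      (fun t ht => (hz₀d t ht).differentiableAt.differentiableWithinAt)
      hz₀c.continuousWithinAt hIoo ?_
    have hcont : ContinuousAt (fun t => abelRHS a b c d z₀ t) T := by
      have := ha.continuousAt hnT
      have := hb.continuousAt hnT
      have := hc.continuousAt hnT
      have := hd.continuousAt hnT
      have := hz₀c.continuousAt (x := T)
      unfold abelRHS
      fun_prop
    refine (hcont.tendsto.mono_left nhdsWithin_le_nhds).congr' ?_
    filter_upwards [hIoo] with t ht
    exact (hz₀d t ht).deriv.symm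
  have hsub2 : Icc T S ⊆ Icc t₀ S := Icc_subset_Icc_left hT.le
  obtain ⟨U, α, hTU, hUS, hαT, hα⟩ := picard_ext hTS (ha.mono hsub2) (hb.mono hsub2)
    (hc.mono hsub2) (hd.mono hsub2) (z₀ T)
  set z : ℝ → ℝ := fun t => if t < T then y t else α t with hz
  have hzy : ∀ t, t < T → z t = y t := fun t ht => by simp [hz, ht]
  have hzα : ∀ t, T ≤ t → z t = α t := fun t ht => by simp [hz, not_lt.2 ht]
  refine ⟨(U : EReal), z, EReal.coe_lt_coe_iff.2 hTU,
    (EReal.coe_le_coe_iff.2 hUS).trans hSτ.le, ?_, fun t ht => hzy t ht.2⟩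
  rw [eIco_coe]
  intro t ht
  rcases lt_trichotomy t T with h | h | h
  · have htI : t ∈ Ico t₀ T := ⟨ht.1, h⟩
    have h1 := (hy t htI).congr (fun s hs => hzy s hs.2) (hzy t h)
    have h2 : abelRHS a b c d y t = abelRHS a b c d z t := by simp only [abelRHS, hzy t h]
    rw [h2] at h1
    refine h1.mono_of_mem_nhdsWithin ?_
    filter_upwards [self_mem_nhdsWithin, nhdsWithin_le_nhds (Iio_mem_nhds h)] with s hs hs'
    exact ⟨hs.1, hs'⟩
  · subst h
    have htU : t ∈ Icc t U := left_mem_Icc.2 hTU.le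
    have e0 : z t = z₀ t := by rw [hzα t le_rfl, hαT]
    have hr := (hα t htU).congr (fun s hs => hzα s hs.1) (hzα t le_rfl)
    have er : abelRHS a b c d α t = abelRHS a b c d z t := by simp only [abelRHS, hzα t le_rfl]
    rw [er] at hr
    have hl : HasDerivWithinAt z (abelRHS a b c d z₀ t) (Icc t₀ t) t := by
      refine (hleft.mono Icc_subset_Iic_self).congr (fun s hs => ?_) e0
      rcases lt_or_eq_of_le hs.2 with h | h
      · rw [hzy s h]; exact hyz ⟨hs.1, h⟩
      · rw [h]; exact e0
    have el : abelRHS a b c d z₀ t = abelRHS a b c d z t := by simp only [abelRHS, e0]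
    rw [el] at hl
    refine (hl.union hr).mono fun s hs => ?_
    rcases le_total s t with h | h
    · exact Or.inl ⟨hs.1, h⟩
    · exact Or.inr ⟨h, hs.2.le⟩
  · have htU : t ∈ Icc T U := ⟨h.le, ht.2.le⟩
    have hr := (hα t htU).congr (fun s hs => hzα s hs.1) (hzα t h.le)
    have er : abelRHS a b c d α t = abelRHS a b c d z t := by simp only [abelRHS, hzα t h.le]
    rw [er] at hr
    exact hr.mono_of_mem_nhdsWithin (mem_nhdsWithin_of_mem_nhds (Icc_mem_nhds h ht.2))

theorem quad_ineq {a b c y z : ℝ} (ha : a < 0) :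
    a * (y ^ 2 + y * z + z ^ 2) + b * (y + z) + c ≤ c - b ^ 2 / a ∧
    (0 < y - z → a * (y ^ 2 + y * z + z ^ 2) + b * (y + z) + c < c - b ^ 2 / a) := by
  have e : c - b ^ 2 / a - (a * (y ^ 2 + y * z + z ^ 2) + b * (y + z) + c) =
      ((b + a * y) ^ 2 + (b + a * z) ^ 2 + (a * y + a * z) ^ 2) / (2 * -a) := by
    have := ha.ne
    field_simp
    ring
  have hp : 0 < 2 * -a := by linarith
  constructor
  · have : 0 ≤ ((b + a * y) ^ 2 + (b + a * z) ^ 2 + (a * y + a * z) ^ 2) / (2 * -a) := by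
      positivity
    linarith
  · intro h
    have h1 : 0 < ((b + a * y) - (b + a * z)) ^ 2 := by
      have : (b + a * y) - (b + a * z) = a * (y - z) := by ring
      rw [this]
      exact sq_pos_iff.2 (mul_neg_of_neg_of_pos ha h).ne
    have : 0 < ((b + a * y) ^ 2 + (b + a * z) ^ 2 + (a * y + a * z) ^ 2) / (2 * -a) := by
      refine div_pos ?_ hp
      nlinarith [sq_nonneg ((b + a * y) + (b + a * z)), sq_nonneg (a * y + a * z)]
    linarith

/-- Theorem 3.1: comparison of solutions of (1.1) with a solution `y₁` of (2.1) from below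
and a supersolution `η` of (2.4) from above, under condition (I) (`a < 0` a.e., `b²/a`
locally integrable) and the integral condition (II). -/
theorem stmt_4 (t₀ : ℝ) (τ₀ : EReal) (hτ : (t₀ : EReal) < τ₀)
    (a b c d a₁ b₁ c₁ d₁ y₁ η : ℝ → ℝ)
    (ha : ContinuousOn a (eIco t₀ τ₀)) (hb : ContinuousOn b (eIco t₀ τ₀))
    (hc : ContinuousOn c (eIco t₀ τ₀)) (hd : ContinuousOn d (eIco t₀ τ₀))
    (ha₁ : ContinuousOn a₁ (eIco t₀ τ₀)) (hb₁ : ContinuousOn b₁ (eIco t₀ τ₀))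
    (hc₁ : ContinuousOn c₁ (eIco t₀ τ₀)) (hd₁ : ContinuousOn d₁ (eIco t₀ τ₀))
    (hy₁ : IsAbelSolOn a₁ b₁ c₁ d₁ y₁ (eIco t₀ τ₀))
    (hη : ∀ t ∈ eIco t₀ τ₀, ∃ v : ℝ, HasDerivWithinAt η v (eIco t₀ τ₀) t ∧
      0 ≤ v + a t * η t ^ 3 + b t * η t ^ 2 + c t * η t + d t)
    (hη0 : y₁ t₀ ≤ η t₀)
    (haneg : ∀ᵐ t ∂(volume.restrict (eIco t₀ τ₀)), a t < 0)
    (hint : ∀ t : ℝ, t₀ < t → (t : EReal) < τ₀ →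
      IntegrableOn (fun s => b s ^ 2 / a s) (Icc t₀ t))
    (γ : ℝ) (hγ : γ ∈ Icc (y₁ t₀) (η t₀))
    (hII : ∀ t ∈ eIco t₀ τ₀,
      0 ≤ γ - y₁ t₀ + ∫ τ in t₀..t,
        Real.exp (∫ s in t₀..τ, (c s - b s ^ 2 / a s)) *
          ((a₁ τ - a τ) * y₁ τ ^ 3 + (b₁ τ - b τ) * y₁ τ ^ 2 +
            (c₁ τ - c τ) * y₁ τ + (d₁ τ - d τ)))
    (t₁ : EReal) (y : ℝ → ℝ) (ht₁ : (t₀ : EReal) < t₁) (ht₁' : t₁ ≤ τ₀)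
    (hy : IsAbelSolOn a b c d y (eIco t₀ t₁))
    (hnc : Noncontinuable a b c d t₀ τ₀ t₁ y)
    (hy0 : y t₀ ∈ Icc γ (η t₀)) :
    t₁ = τ₀ ∧ (∀ t ∈ eIco t₀ τ₀, y₁ t ≤ y t ∧ y t ≤ η t) ∧
      (y₁ t₀ < y t₀ → ∀ t ∈ eIco t₀ τ₀, y₁ t < y t) ∧
      (y t₀ < η t₀ → ∀ t ∈ eIco t₀ τ₀, y t < η t) := by

  have hSS : eIco t₀ t₁ ⊆ eIco t₀ τ₀ := fun t ht => ⟨ht.1, ht.2.trans_le ht₁'⟩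
  have hIcc : ∀ T : ℝ, ∀ τ : EReal, (T : EReal) < τ → Icc t₀ T ⊆ eIco t₀ τ := fun T τ hT t ht =>
    ⟨ht.1, lt_of_le_of_lt (EReal.coe_le_coe_iff.2 ht.2) hT⟩
  have hnh : ∀ T : ℝ, ∀ τ : EReal, (T : EReal) < τ → ∀ t ∈ Ioo t₀ T, eIco t₀ τ ∈ nhds t :=
    fun T τ hT t ht => Filter.mem_of_superset (Icc_mem_nhds ht.1 ht.2) (hIcc T τ hT)
  have hyc : ContinuousOn y (eIco t₀ t₁) := fun t ht => (hy t ht).continuousWithinAt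
  have hy₁c : ContinuousOn y₁ (eIco t₀ τ₀) := fun t ht => (hy₁ t ht).continuousWithinAt
  have hηc : ContinuousOn η (eIco t₀ τ₀) := fun t ht => by
    obtain ⟨v, hv, -⟩ := hη t ht
    exact hv.continuousWithinAt
  have low : ∀ T : ℝ, t₀ < T → (T : EReal) < t₁ →
      y₁ T ≤ y T ∧ (y₁ t₀ < y t₀ → y₁ T < y T) := by
    intro T hT hTt
    have hTτ : (T : EReal) < τ₀ := hTt.trans_le ht₁'
    have hs := hIcc T τ₀ hTτ
    have ha' := ha.mono hs
    have hb' := hb.mono hs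
    have hc' := hc.mono hs
    have hd' := hd.mono hs
    have ha₁' := ha₁.mono hs
    have hb₁' := hb₁.mono hs
    have hc₁' := hc₁.mono hs
    have hd₁' := hd₁.mono hs
    have hy₁c' := hy₁c.mono hs
    have hyc' := hyc.mono (hIcc T t₁ hTt)
    have huI : uIcc t₀ T = Icc t₀ T := uIcc_of_le hT.le
    have key := core_lower hT
      (G := fun t => a t * (y t ^ 2 + y t * y₁ t + y₁ t ^ 2) + b t * (y t + y₁ t) + c t)
      (H := fun t => c t - b t ^ 2 / a t)
      (F := fun τ => (a₁ τ - a τ) * y₁ τ ^ 3 + (b₁ τ - b τ) * y₁ τ ^ 2 +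
            (c₁ τ - c τ) * y₁ τ + (d₁ τ - d τ))
      (w := fun t => y t - y₁ t) (by fun_prop) (by fun_prop)
      (IntervalIntegrable.sub (ContinuousOn.intervalIntegrable (by rwa [huI]))
        ((intervalIntegrable_iff_integrableOn_Icc_of_le hT.le).2 (hint T hT hTτ)))
      (hyc'.sub hy₁c')
      (fun t ht => by
        have htI := Ioo_subset_Icc_self ht
        have h1 := (hy t (hIcc T t₁ hTt htI)).hasDerivAt (hnh T t₁ hTt t ht)
        have h2 := (hy₁ t (hs htI)).hasDerivAt (hnh T τ₀ hTτ t ht)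
        convert! h1.sub h2 using 1
        simp only [abelRHS]
        ring)
      (by
        have h1 : ∀ᵐ t, t ∈ eIco t₀ τ₀ → a t < 0 := by
          refine ae_imp_of_ae_restrict haneg
        filter_upwards [h1] with t ht htm
        exact quad_ineq (ht (hs (Ioc_subset_Icc_self htm))))
      (fun t ht => by
        have h1 := hII t (hs ht)
        have h2 := hy0.1
        refine h1.trans ?_
        gcongr)
    exact ⟨sub_nonneg.1 key.1, fun h => sub_pos.1 (key.2 (sub_pos.2 h))⟩
  have up : ∀ T : ℝ, t₀ < T → (T : EReal) < t₁ →
      y T ≤ η T ∧ (y t₀ < η t₀ → y T < η T) := by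
    intro T hT hTt
    have hTτ : (T : EReal) < τ₀ := hTt.trans_le ht₁'
    have hs := hIcc T τ₀ hTτ
    have ha' := ha.mono hs
    have hb' := hb.mono hs
    have hc' := hc.mono hs
    have hηc' := hηc.mono hs
    have hyc' := hyc.mono (hIcc T t₁ hTt)
    have key := core_upper hT
      (G := fun t => a t * (η t ^ 2 + η t * y t + y t ^ 2) + b t * (η t + y t) + c t)
      (m := fun t => η t - y t) (by fun_prop) (hηc'.sub hyc')
      (fun t ht => by
        have htI := Ioo_subset_Icc_self ht
        have h1 := (hy t (hIcc T t₁ hTt htI)).hasDerivAt (hnh T t₁ hTt t ht)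
        obtain ⟨v, hv, hv0⟩ := hη t (hs htI)
        refine ⟨_, (hv.hasDerivAt (hnh T τ₀ hTτ t ht)).sub h1, ?_⟩
        refine hv0.trans (le_of_eq ?_)
        simp only [abelRHS]
        ring)
    have h0 : 0 ≤ η t₀ - y t₀ := sub_nonneg.2 hy0.2
    have hpos := Real.exp_pos (∫ s in t₀..T,
      (a s * (η s ^ 2 + η s * y s + y s ^ 2) + b s * (η s + y s) + c s))
    refine ⟨sub_nonneg.1 (nonneg_of_mul_nonneg_left (h0.trans key) hpos), fun h => ?_⟩
    exact sub_pos.1 (pos_of_mul_pos_left ((sub_pos.2 h).trans_le key) hpos.le)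
  have bnd : ∀ t ∈ eIco t₀ t₁, y₁ t ≤ y t ∧ y t ≤ η t := by
    intro t ht
    rcases eq_or_lt_of_le ht.1 with h | h
    · rw [← h]; exact ⟨hγ.1.trans hy0.1, hy0.2⟩
    · exact ⟨(low t h ht.2).1, (up t h ht.2).1⟩
  have hτeq : t₁ = τ₀ := by
    by_contra hne
    have hlt : t₁ < τ₀ := lt_of_le_of_ne ht₁' hne
    obtain ⟨T, rfl⟩ : ∃ T : ℝ, (T : EReal) = t₁ :=
      ⟨t₁.toReal, EReal.coe_toReal (hlt.trans_le le_top).ne (bot_le.trans_lt ht₁).ne'⟩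
    rw [EReal.coe_lt_coe_iff] at ht₁
    obtain ⟨M₁, hM₁⟩ := isCompact_Icc.exists_bound_of_continuousOn (hy₁c.mono (hIcc T τ₀ hlt))
    obtain ⟨M₂, hM₂⟩ := isCompact_Icc.exists_bound_of_continuousOn (hηc.mono (hIcc T τ₀ hlt))
    simp only [Real.norm_eq_abs] at hM₁ hM₂
    rw [eIco_coe] at hy bnd
    obtain ⟨t₂, z, h1, h2, h3, h4⟩ := abel_extend ht₁ hlt ha hb hc hd hy (max M₁ M₂)
      (fun t ht => by
        have htI := Ico_subset_Icc_self ht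
        have e1 := abs_le.1 (hM₁ t htI)
        have e2 := abs_le.1 (hM₂ t htI)
        have e3 := bnd t ht
        have e4 := le_max_left M₁ M₂
        have e5 := le_max_right M₁ M₂
        exact abs_le.2 ⟨by linarith, by linarith⟩)
    exact hnc ⟨t₂, z, h1, h2, h3, by rw [eIco_coe]; exact h4⟩
  subst hτeq
  refine ⟨rfl, bnd, fun h t ht => ?_, fun h t ht => ?_⟩
  · rcases eq_or_lt_of_le ht.1 with h' | h'
    · rwa [← h']
    · exact (low t h' ht.2).2 h
  · rcases eq_or_lt_of_le ht.1 with h' | h'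
    · rwa [← h']
    · exact (up t h' ht.2).2 h
end

section
/- Let y₁ and y₂ be solutions of equations (2.1) and (3.10) respectively on [t₀, τ₀) with y₁(t₀) ≤ y₂(t₀). Assume: (I) a(t) < 0 for almost every t ∈ [t₀, τ₀) and b²/a is locally integrable on [t₀, τ₀); (II) there exists γ₁ ∈ [y₁(t₀), y₂(t₀)] such that for all t ∈ [t₀, τ₀), γ₁ − y₁(t₀) + ∫_{t₀}^{t} exp(∫_{t₀}^{τ} [c(s) − b(s)²/a(s)] ds)·[(a₁(τ) − a(τ))y₁(τ)³ + (b₁(τ) − b(τ))y₁(τ)² + (c₁(τ) − c(τ))y₁(τ) + d₁(τ) − d(τ)] dτ ≥ 0; (III) there exists γ₂ ∈ [γ₁, y₂(t₀)] such that for all t ∈ [t₀, τ₀), γ₂ − y₂(t₀) + ∫_{t₀}^{t} exp(∫_{t₀}^{τ} [c(s) − b(s)²/a(s)] ds)·[(a₂(τ) − a(τ))y₂(τ)³ + (b₂(τ) − b(τ))y₂(τ)² + (c₂(τ) − c(τ))y₂(τ) + d₂(τ) − d(τ)] dτ ≤ 0. Then every noncontinuable solution y of (1.1) with y(t₀) ∈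 [γ₁, γ₂] is defined on all of [t₀, τ₀) and satisfies y₁(t) ≤ y(t) ≤ y₂(t) for all t ∈ [t₀, τ₀). Furthermore, if y₁(t₀) < y(t₀) then y₁(t) < y(t) on [t₀, τ₀), and if y(t₀) < y₂(t₀) then y(t) < y₂(t) on [t₀, τ₀). -/
open Set MeasureTheory intervalIntegral

lemma aux_ac_exp {f : ℝ → ℝ} {p q : ℝ} (hf : AbsolutelyContinuousOnInterval f p q) :
    AbsolutelyContinuousOnInterval (fun x => Real.exp (f x)) p q := by
  obtain ⟨M, hM⟩ := isCompact_uIcc.exists_bound_of_continuousOn hf.continuousOn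
  obtain ⟨C, hC⟩ := (Real.contDiff_exp (n := 1)).contDiffOn.exists_lipschitzOnWith
    (s := Icc (-M) M) (by simp) (convex_Icc _ _) isCompact_Icc
  unfold AbsolutelyContinuousOnInterval at hf ⊢
  have h2 := hf.const_mul (C : ℝ)
  rw [mul_zero] at h2
  refine squeeze_zero' (Filter.Eventually.of_forall fun E =>
    Finset.sum_nonneg fun _ _ => dist_nonneg) ?_ h2
  refine Filter.mem_inf_of_right ?_
  intro E hE
  simp only [Set.mem_ofPred_eq, Finset.mul_sum]
  refine Finset.sum_le_sum fun i hi => ?_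
  have h := hE.1 i hi
  refine hC.dist_le_mul _ ?_ _ ?_
  · have := hM _ h.1
    rw [Real.norm_eq_abs, abs_le] at this
    exact this
  · have := hM _ h.2
    rw [Real.norm_eq_abs, abs_le] at this
    exact this

lemma aux_key {t₀ T : ℝ} (hT : t₀ < T) {G F h w : ℝ → ℝ} {κ : ℝ}
    (hG : ContinuousOn G (Icc t₀ T)) (hF : ContinuousOn F (Icc t₀ T))
    (hh : IntervalIntegrable h volume t₀ T)
    (hGh : ∀ᵐ x, x ∈ Icc t₀ T → G x ≤ h x)
    (hw : ∀ x ∈ Icc t₀ T, HasDerivWithinAt w (-(G x * w x) + F x) (Icc t₀ T) x)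
    (hκ : κ ≤ w t₀)
    (hΦ : ∀ t ∈ Icc t₀ T, 0 ≤ κ + ∫ τ in t₀..t, Real.exp (∫ s in t₀..τ, h s) * F τ) :
    0 ≤ w T ∧ ((∀ᵐ x, x ∈ Icc t₀ T → w x ≠ 0 → G x < h x) → 0 < w t₀ → 0 < w T) := by
  have hu : uIcc t₀ T = Icc t₀ T := uIcc_of_le hT.le
  have hwc : ContinuousOn w (Icc t₀ T) := fun x hx => (hw x hx).continuousWithinAt
  have hw_ac : AbsolutelyContinuousOnInterval w t₀ T := by
    have hc : ContinuousOn (fun x => -(G x * w x) + F x) (Icc t₀ T) := by fun_prop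
    obtain ⟨C, hC⟩ := isCompact_Icc.exists_bound_of_continuousOn hc
    have : LipschitzOnWith C.toNNReal w (uIcc t₀ T) := by
      rw [hu]
      refine (convex_Icc t₀ T).lipschitzOnWith_of_nnnorm_hasDerivWithin_le hw fun x hx => ?_
      rw [← NNReal.coe_le_coe]
      exact (hC x hx).trans (Real.le_coe_toNNReal C)
    exact this.absolutelyContinuousOnInterval
  have hGi : IntervalIntegrable G volume t₀ T := by
    apply ContinuousOn.intervalIntegrable; rwa [hu]
  set P : ℝ → ℝ := fun x => ∫ s in t₀..x, G s with hP
  set H : ℝ → ℝ := fun x => ∫ s in t₀..x, h s with hH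
  have hP_ac : AbsolutelyContinuousOnInterval P t₀ T :=
    hGi.absolutelyContinuousOnInterval_intervalIntegral (by simp)
  have hH_ac : AbsolutelyContinuousOnInterval H t₀ T :=
    hh.absolutelyContinuousOnInterval_intervalIntegral (by simp)
  have hHc : ContinuousOn H (Icc t₀ T) := hu ▸ hH_ac.continuousOn
  have hPc : ContinuousOn P (Icc t₀ T) := hu ▸ hP_ac.continuousOn
  have hEFi : IntervalIntegrable (fun τ => Real.exp (H τ) * F τ) volume t₀ T := by
    apply ContinuousOn.intervalIntegrable
    rw [hu]
    exact (Real.continuous_exp.comp_continuousOn hHc).mul hF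
  set Φ : ℝ → ℝ := fun t => κ + ∫ τ in t₀..t, Real.exp (H τ) * F τ with hΦd
  have hΨ_ac : AbsolutelyContinuousOnInterval
      (fun t => ∫ τ in t₀..t, Real.exp (H τ) * F τ) t₀ T :=
    hEFi.absolutelyContinuousOnInterval_intervalIntegral (by simp)
  have hκ_ac : AbsolutelyContinuousOnInterval (fun _ : ℝ => κ) t₀ T :=
    ((LipschitzWith.const κ).lipschitzOnWith (s := uIcc t₀ T)).absolutelyContinuousOnInterval
  have hΦ_ac : AbsolutelyContinuousOnInterval Φ t₀ T := hκ_ac.add hΨ_ac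
  have hΦc : ContinuousOn Φ (Icc t₀ T) := hu ▸ hΦ_ac.continuousOn
  have hE_ac : AbsolutelyContinuousOnInterval (fun x => Real.exp (P x - H x)) t₀ T :=
    aux_ac_exp (hP_ac.sub hH_ac)
  have hQ_ac : AbsolutelyContinuousOnInterval
      (fun x => Real.exp (P x) * w x - Real.exp (P x - H x) * Φ x) t₀ T :=
    ((aux_ac_exp hP_ac).mul hw_ac).sub (hE_ac.mul hΦ_ac)
  have h1 : ∀ᵐ x : ℝ, x ≠ t₀ := by simp [ae_iff, measure_singleton]
  have h2 : ∀ᵐ x : ℝ, x ≠ T := by simp [ae_iff, measure_singleton]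
  have hder : ∀ᵐ x, x ∈ Icc t₀ T →
      deriv (fun x => Real.exp (P x) * w x - Real.exp (P x - H x) * Φ x) x
        = Real.exp (P x - H x) * Φ x * (h x - G x) := by
    filter_upwards [h1, h2, hGi.ae_hasDerivAt_integral, hh.ae_hasDerivAt_integral,
      hEFi.ae_hasDerivAt_integral] with x hx1 hx2 hxG hxh hxE hx
    have hx' := hu.symm ▸ hx
    have dP : HasDerivAt P (G x) x := hxG hx' t₀ (by simp)
    have dH : HasDerivAt H (h x) x := hxh hx' t₀ (by simp)
    have dΦ : HasDerivAt Φ (Real.exp (H x) * F x) x := (hxE hx' t₀ (by simp)).const_add κ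
    have dw : HasDerivAt w (-(G x * w x) + F x) x :=
      (hw x hx).hasDerivAt (Icc_mem_nhds (lt_of_le_of_ne hx.1 (Ne.symm hx1))
        (lt_of_le_of_ne hx.2 hx2))
    have := (dP.exp.mul dw).sub ((dP.sub dH).exp.mul dΦ)
    refine this.deriv.trans ?_
    have he : Real.exp (P x) = Real.exp (P x - H x) * Real.exp (H x) := by
      rw [← Real.exp_add]; congr 1; ring
    simp only [Pi.sub_apply]
    rw [he]; ring
  have hI := hQ_ac.integral_deriv_eq_sub
  have hQi := hQ_ac.intervalIntegrable_deriv
  have hP0 : P t₀ = 0 := by simp [hP]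
  have hH0 : H t₀ = 0 := by simp [hH]
  have hΦ0 : Φ t₀ = κ := by simp [hΦd]
  simp only [hP0, hH0, hΦ0, sub_zero, Real.exp_zero, one_mul] at hI
  have hnn : ∀ᵐ x, x ∈ Icc t₀ T →
      0 ≤ deriv (fun x => Real.exp (P x) * w x - Real.exp (P x - H x) * Φ x) x := by
    filter_upwards [hder, hGh] with x hx hxg hxI
    rw [hx hxI]
    exact mul_nonneg (mul_nonneg (Real.exp_pos _).le (hΦ x hxI)) (sub_nonneg.2 (hxg hxI))
  have hnn' : 0 ≤ᵐ[volume.restrict (Ioc t₀ T)]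
      deriv (fun x => Real.exp (P x) * w x - Real.exp (P x - H x) * Φ x) := by
    refine (ae_restrict_iff' measurableSet_Ioc).2 ?_
    filter_upwards [hnn] with x hx hxI using hx (Ioc_subset_Icc_self hxI)
  have hIn : 0 ≤ ∫ x in t₀..T,
      deriv (fun x => Real.exp (P x) * w x - Real.exp (P x - H x) * Φ x) x :=
    intervalIntegral.integral_nonneg_of_ae_restrict hT.le
      ((ae_restrict_iff' measurableSet_Icc).2 hnn)
  have hΦT : 0 ≤ Real.exp (P T - H T) * Φ T :=
    mul_nonneg (Real.exp_pos _).le (hΦ T (right_mem_Icc.2 hT.le))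
  have hmain : 0 ≤ Real.exp (P T) * w T := by linarith
  refine ⟨nonneg_of_mul_nonneg_right hmain (Real.exp_pos _), fun hst hw0 => ?_⟩
  by_contra hcon
  have hle : Real.exp (P T) * w T ≤ 0 :=
    mul_nonpos_of_nonneg_of_nonpos (Real.exp_pos _).le (not_lt.1 hcon)
  have hκw : κ = w t₀ := by linarith
  have hI0 : ∫ x in t₀..T,
      deriv (fun x => Real.exp (P x) * w x - Real.exp (P x - H x) * Φ x) x = 0 := by linarith
  rw [intervalIntegral.integral_of_le hT.le,
    integral_eq_zero_iff_of_nonneg_ae hnn' ((intervalIntegrable_iff_integrableOn_Ioc_of_le hT.le).1 hQi)] at hI0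
  have hz := (ae_restrict_iff' measurableSet_Ioc).1 hI0
  have hpos : ∀ᶠ x in nhdsWithin t₀ (Icc t₀ T), 0 < w x ∧ 0 < Φ x := by
    have ht := left_mem_Icc.2 hT.le
    refine ((hwc t₀ ht).eventually (lt_mem_nhds hw0)).and
      ((hΦc t₀ ht).eventually (lt_mem_nhds ?_))
    rw [hΦ0, hκw]; exact hw0
  have hpos2 : ∀ᶠ x in nhdsWithin t₀ (Ioi t₀), 0 < w x ∧ 0 < Φ x := by
    rw [← nhdsWithin_Ioc_eq_nhdsGT hT]
    exact hpos.filter_mono (nhdsWithin_mono _ Ioc_subset_Icc_self)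
  obtain ⟨δ, hδ, hsub⟩ := (mem_nhdsGT_iff_exists_Ioo_subset).1 hpos2
  have hae : ∀ᵐ x : ℝ, x ∉ Ioo t₀ (min δ T) := by
    filter_upwards [hz, hder, hst] with x hxz hxd hxs hx
    have hx1 : x ∈ Ioc t₀ T := ⟨hx.1, (hx.2.trans_le (min_le_right _ _)).le⟩
    have hx2 := Ioc_subset_Icc_self hx1
    have hp := hsub ⟨hx.1, hx.2.trans_le (min_le_left _ _)⟩
    have h3 := hxz hx1
    rw [hxd hx2] at h3
    have h4 : 0 < Real.exp (P x - H x) * Φ x * (h x - G x) :=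
      mul_pos (mul_pos (Real.exp_pos _) hp.2) (sub_pos.2 (hxs hx2 hp.1.ne'))
    exact h4.ne' h3
  have h5 : volume (Ioo t₀ (min δ T)) = 0 := by
    rw [ae_iff] at hae
    simp only [not_not] at hae
    exact hae
  rw [Real.volume_Ioo, ENNReal.ofReal_eq_zero] at h5
  have : t₀ < min δ T := lt_min hδ hT
  linarith

lemma aux_cmp {t₀ T : ℝ} (hT : t₀ < T) {a b c z x F : ℝ → ℝ} {κ : ℝ}
    (ha : ContinuousOn a (Icc t₀ T)) (hb : ContinuousOn b (Icc t₀ T))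
    (hc : ContinuousOn c (Icc t₀ T)) (hF : ContinuousOn F (Icc t₀ T))
    (hz : ContinuousOn z (Icc t₀ T)) (hx : ContinuousOn x (Icc t₀ T))
    (haneg : ∀ᵐ t, t ∈ Icc t₀ T → a t < 0)
    (hint : IntegrableOn (fun s => b s ^ 2 / a s) (Icc t₀ T))
    (hw : ∀ t ∈ Icc t₀ T, HasDerivWithinAt (fun t => z t - x t)
      (-((a t * (z t ^ 2 + z t * x t + x t ^ 2) + b t * (z t + x t) + c t) * (z t - x t)) + F t)
      (Icc t₀ T) t)
    (hκ : κ ≤ z t₀ - x t₀)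
    (hΦ : ∀ t ∈ Icc t₀ T, 0 ≤ κ + ∫ τ in t₀..t,
      Real.exp (∫ s in t₀..τ, (c s - b s ^ 2 / a s)) * F τ) :
    x T ≤ z T ∧ (x t₀ < z t₀ → x T < z T) := by
  have hu : uIcc t₀ T = Icc t₀ T := uIcc_of_le hT.le
  have hh : IntervalIntegrable (fun s => c s - b s ^ 2 / a s) volume t₀ T := by
    refine IntervalIntegrable.sub (ContinuousOn.intervalIntegrable (hu ▸ hc)) ?_
    rw [intervalIntegrable_iff_integrableOn_Icc_of_le hT.le]
    exact hint
  have hid : ∀ A B Z X : ℝ, A < 0 → -(B ^ 2 / A) - (A * (Z ^ 2 + Z * X + X ^ 2) + B * (Z + X))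
      = (-A)⁻¹ * ((B + A * (Z + X) / 2) ^ 2 + A ^ 2 * ((Z + X) ^ 2 + 2 * Z ^ 2 + 2 * X ^ 2) / 4) := by
    intro A B Z X hA
    have := hA.ne
    field_simp
    ring
  have := aux_key hT (G := fun t => a t * (z t ^ 2 + z t * x t + x t ^ 2) + b t * (z t + x t) + c t)
    (F := F) (h := fun s => c s - b s ^ 2 / a s) (w := fun t => z t - x t) (κ := κ)
    (by fun_prop) hF hh ?_ hw hκ hΦ
  · refine ⟨sub_nonneg.1 this.1, fun h0 => sub_pos.1 (this.2 ?_ (sub_pos.2 h0))⟩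
    filter_upwards [haneg] with t ht hti hne
    have hA := ht hti
    have h1 := hid (a t) (b t) (z t) (x t) hA
    have h2 : 0 < (-(a t))⁻¹ * ((b t + a t * (z t + x t) / 2) ^ 2
        + a t ^ 2 * ((z t + x t) ^ 2 + 2 * z t ^ 2 + 2 * x t ^ 2) / 4) := by
      refine mul_pos (inv_pos.2 (neg_pos.2 hA)) ?_
      have h3 : 0 < a t ^ 2 := by have := hA.ne; positivity
      have h4 : 0 < (z t + x t) ^ 2 + 2 * z t ^ 2 + 2 * x t ^ 2 := by
        have h5 : 0 < (z t - x t) ^ 2 := by positivity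
        nlinarith [sq_nonneg (z t + x t)]
      positivity
    linarith
  · filter_upwards [haneg] with t ht hti
    have hA := ht hti
    have h1 := hid (a t) (b t) (z t) (x t) hA
    have h2 : 0 ≤ (-(a t))⁻¹ * ((b t + a t * (z t + x t) / 2) ^ 2
        + a t ^ 2 * ((z t + x t) ^ 2 + 2 * z t ^ 2 + 2 * x t ^ 2) / 4) := by
      refine mul_nonneg (inv_pos.2 (neg_pos.2 hA)).le ?_
      positivity
    linarith

lemma aux_ext {t₀ r : ℝ} {τ₀ : EReal} (h0 : t₀ < r) (hr : (r : EReal) < τ₀)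
    {a b c d y : ℝ → ℝ}
    (ha : ContinuousOn a (eIco t₀ τ₀)) (hb : ContinuousOn b (eIco t₀ τ₀))
    (hc : ContinuousOn c (eIco t₀ τ₀)) (hd : ContinuousOn d (eIco t₀ τ₀))
    (hy : IsAbelSolOn a b c d y (eIco t₀ r)) {M : ℝ} (hM : ∀ t ∈ eIco t₀ r, |y t| ≤ M) :
    ¬ Noncontinuable a b c d t₀ τ₀ r y := by
  obtain ⟨T, hrT, hT⟩ := EReal.lt_iff_exists_real_btwn.1 hr
  rw [EReal.coe_lt_coe_iff] at hrT
  have hsub : Icc t₀ T ⊆ eIco t₀ τ₀ := fun t ht =>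
    ⟨ht.1, (EReal.coe_le_coe_iff.2 ht.2).trans_lt hT⟩
  have hIco : ∀ s : ℝ, eIco t₀ (s : EReal) = Ico t₀ s := fun s => by
    ext t; simp [eIco]
  rw [hIco] at hy hM
  have ha := ha.mono hsub
  have hb := hb.mono hsub
  have hc := hc.mono hsub
  have hd := hd.mono hsub
  obtain ⟨A, hA⟩ := isCompact_Icc.exists_bound_of_continuousOn ha
  obtain ⟨B, hB⟩ := isCompact_Icc.exists_bound_of_continuousOn hb
  obtain ⟨C, hC⟩ := isCompact_Icc.exists_bound_of_continuousOn hc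
  obtain ⟨D, hD⟩ := isCompact_Icc.exists_bound_of_continuousOn hd
  simp only [Real.norm_eq_abs] at hA hB hC hD
  have htT : t₀ ∈ Icc t₀ T := ⟨le_rfl, (h0.trans hrT).le⟩
  have hA0 := (abs_nonneg _).trans (hA _ htT)
  have hB0 := (abs_nonneg _).trans (hB _ htT)
  have hC0 := (abs_nonneg _).trans (hC _ htT)
  have hD0 := (abs_nonneg _).trans (hD _ htT)
  -- bound on the vector field
  have hbd : ∀ R : ℝ, ∀ t ∈ Icc t₀ T, ∀ x : ℝ, |x| ≤ R →
      |-(a t * x ^ 3 + b t * x ^ 2 + c t * x + d t)| ≤ A * R ^ 3 + B * R ^ 2 + C * R + D := by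
    intro R t ht x hx
    have hR := (abs_nonneg _).trans hx
    rw [abs_neg]
    refine (abs_add_le _ _).trans (add_le_add ((abs_add_le _ _).trans (add_le_add
      ((abs_add_le _ _).trans (add_le_add ?_ ?_)) ?_)) (hD t ht))
    · rw [abs_mul, abs_pow]; have := hA t ht; gcongr
    · rw [abs_mul, abs_pow]; have := hB t ht; gcongr
    · rw [abs_mul]; have := hC t ht; gcongr
  -- the solution is Lipschitz
  have hlip : LipschitzOnWith (A * M ^ 3 + B * M ^ 2 + C * M + D).toNNReal y (Ico t₀ r) := by
    refine (convex_Ico t₀ r).lipschitzOnWith_of_nnnorm_hasDerivWithin_le hy fun x hx => ?_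
    rw [← NNReal.coe_le_coe]
    exact (hbd M x ⟨hx.1, (hx.2.trans hrT).le⟩ _ (hM x hx)).trans (Real.le_coe_toNNReal _)
  obtain ⟨g, hg, hgy⟩ := hlip.extend_real
  have hgc : Continuous g := hg.continuous
  have hgd : ∀ t ∈ Ico t₀ r, HasDerivWithinAt g (abelRHS a b c d g t) (Ico t₀ r) t := by
    intro t ht
    have h1 := (hy t ht).congr (fun s hs => (hgy hs).symm) (hgy ht).symm
    simpa only [abelRHS, hgy ht] using h1
  have hrI : r ∈ Icc t₀ T := ⟨h0.le, hrT.le⟩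
  have hRc : ContinuousOn (abelRHS a b c d g) (Icc t₀ T) := by
    unfold abelRHS; fun_prop
  have hgdr : HasDerivWithinAt g (abelRHS a b c d g r) (Iic r) r := by
    have hd1 : ∀ t ∈ Ioo t₀ r, HasDerivAt g (abelRHS a b c d g t) t := fun t ht =>
      (hgd t ⟨ht.1.le, ht.2⟩).hasDerivAt (Ico_mem_nhds ht.1 ht.2)
    refine hasDerivWithinAt_Iic_of_tendsto_deriv (s := Ioo t₀ r)
      (fun t ht => (hd1 t ht).differentiableAt.differentiableWithinAt)
      hgc.continuousWithinAt (Ioo_mem_nhdsLT h0) ?_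
    have h1 : Filter.Tendsto (abelRHS a b c d g) (nhdsWithin r (Iio r))
        (nhds (abelRHS a b c d g r)) := by
      rw [← nhdsWithin_Ioo_eq_nhdsLT h0]
      exact (hRc r hrI).mono_left
        (nhdsWithin_mono _ fun t ht => ⟨ht.1.le, (ht.2.trans hrT).le⟩)
    refine h1.congr' ?_
    filter_upwards [Ioo_mem_nhdsLT h0] with t ht using (hd1 t ht).deriv.symm
  -- Picard-Lindelof from the point `(r, g r)`
  set R := |g r| + 1 with hRdef
  set N := A * R ^ 3 + B * R ^ 2 + C * R + D with hN
  have hR0 : 0 ≤ R := by positivity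
  have hN0 : 0 ≤ N := by positivity
  set ε := min (T - r) (1 / (N + 1)) with hε
  have hε0 : 0 < ε := lt_min (by linarith) (by positivity)
  have hεT : r + ε ≤ T := by have := min_le_left (T - r) (1 / (N + 1)); linarith
  have hball : ∀ x ∈ Metric.closedBall (g r) (1 : ℝ), |x| ≤ R := by
    intro x hx
    rw [Metric.mem_closedBall, Real.dist_eq] at hx
    have := abs_sub_abs_le_abs_sub x (g r)
    linarith
  have hIs : Icc r (r + ε) ⊆ Icc t₀ T := Icc_subset_Icc h0.le hεT
  have hpl : IsPicardLindelof (fun t x => -(a t * x ^ 3 + b t * x ^ 2 + c t * x + d t))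
      (tmin := r) (tmax := r + ε) ⟨r, by simp [hε0.le]⟩ (g r) 1 0 N.toNNReal
      (A * (3 * R ^ 2) + B * (2 * R) + C).toNNReal := by
    refine ⟨fun t ht => ?_, fun x hx => ?_, fun t ht x hx => ?_, ?_⟩
    · refine LipschitzOnWith.of_dist_le_mul fun x hx x' hx' => ?_
      have hx := hball x hx
      have hx' := hball x' hx'
      rw [Real.dist_eq, Real.dist_eq]
      have e : -(a t * x ^ 3 + b t * x ^ 2 + c t * x + d t)
          - -(a t * x' ^ 3 + b t * x' ^ 2 + c t * x' + d t)
          = -(a t * (x ^ 2 + x * x' + x' ^ 2) + b t * (x + x') + c t) * (x - x') := by ring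
      rw [e, abs_mul, abs_neg]
      gcongr
      refine le_trans ?_ (Real.le_coe_toNNReal _)
      have h1 := hA t (hIs ht)
      have h2 := hB t (hIs ht)
      have h3 := hC t (hIs ht)
      refine (abs_add_le _ _).trans (add_le_add ((abs_add_le _ _).trans (add_le_add ?_ ?_)) h3)
      · rw [abs_mul]
        gcongr
        refine (abs_add_le _ _).trans ((add_le_add_left (abs_add_le _ _) _).trans ?_)
        rw [abs_mul, abs_pow, abs_pow]
        have : |x| ^ 2 + |x| * |x'| + |x'| ^ 2 ≤ R ^ 2 + R * R + R ^ 2 := by gcongr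
        linarith
      · rw [abs_mul]
        gcongr
        refine (abs_add_le _ _).trans ?_
        linarith
    · have ha := ha.mono hIs
      have hb := hb.mono hIs
      have hc := hc.mono hIs
      have hd := hd.mono hIs
      fun_prop
    · exact (hbd R t (hIs ht) x (hball x hx)).trans (Real.le_coe_toNNReal _)
    · rw [Real.coe_toNNReal _ hN0]
      simp only [add_sub_cancel_left, sub_self, NNReal.coe_one, NNReal.coe_zero, sub_zero]
      rw [max_eq_left hε0.le]
      have h1 : ε ≤ 1 / (N + 1) := min_le_right _ _
      calc N * ε ≤ N * (1 / (N + 1)) := by gcongr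
        _ ≤ 1 := by rw [mul_one_div, div_le_one (by positivity)]; linarith
  obtain ⟨α, hα0, hα⟩ := hpl.exists_eq_forall_mem_Icc_hasDerivWithinAt₀
  simp only at hα0
  -- glue
  intro hnc
  apply hnc
  let z : ℝ → ℝ := fun t => if t ≤ r then g t else α t
  have hzg : ∀ t, t ≤ r → z t = g t := fun t ht => if_pos ht
  have hzα : ∀ t, r ≤ t → z t = α t := fun t ht => by
    rcases ht.eq_or_lt with rfl | h
    · rw [hzg _ le_rfl, hα0]
    · exact if_neg (not_le.2 h)
  refine ⟨((r + ε : ℝ) : EReal), z, EReal.coe_lt_coe_iff.2 (by linarith),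
    ((EReal.coe_le_coe_iff.2 hεT).trans_lt hT).le, ?_, ?_⟩
  · rw [hIco]
    intro t ht
    have hL : t ≤ r → HasDerivWithinAt z (abelRHS a b c d z t) (Icc t₀ r) t := by
      intro htr
      have h1 : HasDerivWithinAt g (abelRHS a b c d g t) (Icc t₀ r) t := by
        rcases htr.eq_or_lt with rfl | h
        · exact hgdr.mono Icc_subset_Iic_self
        · refine (hgd t ⟨ht.1, h⟩).mono_of_mem_nhdsWithin ?_
          filter_upwards [self_mem_nhdsWithin, mem_nhdsWithin_of_mem_nhds (Iio_mem_nhds h)]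
            with s hs1 hs2 using ⟨hs1.1, hs2⟩
      have h2 := h1.congr (fun s hs => hzg s hs.2) (hzg t htr)
      simpa only [abelRHS, hzg t htr] using h2
    have hRt : r ≤ t → HasDerivWithinAt z (abelRHS a b c d z t) (Icc r (r + ε)) t := by
      intro htr
      have h2 := (hα t ⟨htr, ht.2.le⟩).congr (fun s hs => hzα s hs.1) (hzα t htr)
      simpa only [abelRHS, hzα t htr] using h2
    rcases lt_trichotomy t r with h | h | h
    · refine (hL h.le).mono_of_mem_nhdsWithin ?_
      filter_upwards [self_mem_nhdsWithin, mem_nhdsWithin_of_mem_nhds (Iio_mem_nhds h)]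
        with s hs1 hs2 using ⟨hs1.1, le_of_lt hs2⟩
    · refine ((hL h.le).union (hRt h.ge)).mono ?_
      intro s hs
      rcases le_total s r with h' | h'
      · exact Or.inl ⟨hs.1, h'⟩
      · exact Or.inr ⟨h', hs.2.le⟩
    · refine (hRt h.le).mono_of_mem_nhdsWithin ?_
      filter_upwards [self_mem_nhdsWithin, mem_nhdsWithin_of_mem_nhds (Ioi_mem_nhds h)]
        with s hs1 hs2 using ⟨le_of_lt hs2, hs1.2.le⟩
  · rw [hIco]
    intro t ht
    rw [hzg t ht.2.le, hgy ht]

/-- Theorem 3.3: two-sided comparison of solutions of (1.1) with solutions `y₁` of (2.1)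
and `y₂` of (3.10), under condition (I) (`a < 0` a.e., `b²/a` locally integrable) and
the integral conditions (II), (III). -/
theorem stmt_6 (t₀ : ℝ) (τ₀ : EReal) (hτ : (t₀ : EReal) < τ₀)
    (a b c d a₁ b₁ c₁ d₁ a₂ b₂ c₂ d₂ y₁ y₂ : ℝ → ℝ)
    (ha : ContinuousOn a (eIco t₀ τ₀)) (hb : ContinuousOn b (eIco t₀ τ₀))
    (hc : ContinuousOn c (eIco t₀ τ₀)) (hd : ContinuousOn d (eIco t₀ τ₀))
    (ha₁ : ContinuousOn a₁ (eIco t₀ τ₀)) (hb₁ : ContinuousOn b₁ (eIco t₀ τ₀))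
    (hc₁ : ContinuousOn c₁ (eIco t₀ τ₀)) (hd₁ : ContinuousOn d₁ (eIco t₀ τ₀))
    (ha₂ : ContinuousOn a₂ (eIco t₀ τ₀)) (hb₂ : ContinuousOn b₂ (eIco t₀ τ₀))
    (hc₂ : ContinuousOn c₂ (eIco t₀ τ₀)) (hd₂ : ContinuousOn d₂ (eIco t₀ τ₀))
    (hy₁ : IsAbelSolOn a₁ b₁ c₁ d₁ y₁ (eIco t₀ τ₀))
    (hy₂ : IsAbelSolOn a₂ b₂ c₂ d₂ y₂ (eIco t₀ τ₀))
    (h12 : y₁ t₀ ≤ y₂ t₀)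
    (haneg : ∀ᵐ t ∂(volume.restrict (eIco t₀ τ₀)), a t < 0)
    (hint : ∀ t : ℝ, t₀ < t → (t : EReal) < τ₀ →
      IntegrableOn (fun s => b s ^ 2 / a s) (Icc t₀ t))
    (γ₁ : ℝ) (hγ₁ : γ₁ ∈ Icc (y₁ t₀) (y₂ t₀))
    (hII : ∀ t ∈ eIco t₀ τ₀,
      0 ≤ γ₁ - y₁ t₀ + ∫ τ in t₀..t,
        Real.exp (∫ s in t₀..τ, (c s - b s ^ 2 / a s)) *
          ((a₁ τ - a τ) * y₁ τ ^ 3 + (b₁ τ - b τ) * y₁ τ ^ 2 +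
            (c₁ τ - c τ) * y₁ τ + (d₁ τ - d τ)))
    (γ₂ : ℝ) (hγ₂ : γ₂ ∈ Icc γ₁ (y₂ t₀))
    (hIII : ∀ t ∈ eIco t₀ τ₀,
      γ₂ - y₂ t₀ + (∫ τ in t₀..t,
        Real.exp (∫ s in t₀..τ, (c s - b s ^ 2 / a s)) *
          ((a₂ τ - a τ) * y₂ τ ^ 3 + (b₂ τ - b τ) * y₂ τ ^ 2 +
            (c₂ τ - c τ) * y₂ τ + (d₂ τ - d τ))) ≤ 0)
    (t₁ : EReal) (y : ℝ → ℝ) (ht₁ : (t₀ : EReal) < t₁) (ht₁' : t₁ ≤ τ₀)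
    (hy : IsAbelSolOn a b c d y (eIco t₀ t₁))
    (hnc : Noncontinuable a b c d t₀ τ₀ t₁ y)
    (hy0 : y t₀ ∈ Icc γ₁ γ₂) :
    t₁ = τ₀ ∧ (∀ t ∈ eIco t₀ τ₀, y₁ t ≤ y t ∧ y t ≤ y₂ t) ∧
      (y₁ t₀ < y t₀ → ∀ t ∈ eIco t₀ τ₀, y₁ t < y t) ∧
      (y t₀ < y₂ t₀ → ∀ t ∈ eIco t₀ τ₀, y t < y₂ t) := by
  have hy₁c : ContinuousOn y₁ (eIco t₀ τ₀) := fun t ht => (hy₁ t ht).continuousWithinAt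
  have hy₂c : ContinuousOn y₂ (eIco t₀ τ₀) := fun t ht => (hy₂ t ht).continuousWithinAt
  have hyc : ContinuousOn y (eIco t₀ t₁) := fun t ht => (hy t ht).continuousWithinAt
  have hmeas : MeasurableSet (eIco t₀ τ₀) := by
    have : eIco t₀ τ₀ = Ici t₀ ∩ (fun t : ℝ => (t : EReal)) ⁻¹' Iio τ₀ := rfl
    rw [this]
    exact measurableSet_Ici.inter (measurable_coe_real_ereal measurableSet_Iio)
  have haneg' := (ae_restrict_iff' hmeas).1 haneg
  have main : ∀ T ∈ eIco t₀ t₁, (y₁ T ≤ y T ∧ (y₁ t₀ < y t₀ → y₁ T < y T)) ∧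
      (y T ≤ y₂ T ∧ (y t₀ < y₂ t₀ → y T < y₂ T)) := by
    intro T hT
    rcases hT.1.eq_or_lt with rfl | h0
    · exact ⟨⟨hγ₁.1.trans hy0.1, id⟩, ⟨hy0.2.trans hγ₂.2, id⟩⟩
    have hs1 : Icc t₀ T ⊆ eIco t₀ t₁ := fun t ht =>
      ⟨ht.1, (EReal.coe_le_coe_iff.2 ht.2).trans_lt hT.2⟩
    have hs : Icc t₀ T ⊆ eIco t₀ τ₀ := fun t ht =>
      ⟨ht.1, (hs1 ht).2.trans_le ht₁'⟩
    have hTτ : (T : EReal) < τ₀ := hT.2.trans_le ht₁'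
    have haneg'' : ∀ᵐ t, t ∈ Icc t₀ T → a t < 0 := by
      filter_upwards [haneg'] with t ht hti using ht (hs hti)
    have ha := ha.mono hs
    have hb := hb.mono hs
    have hc := hc.mono hs
    have hd := hd.mono hs
    have ha₁ := ha₁.mono hs
    have hb₁ := hb₁.mono hs
    have hc₁ := hc₁.mono hs
    have hd₁ := hd₁.mono hs
    have ha₂ := ha₂.mono hs
    have hb₂ := hb₂.mono hs
    have hc₂ := hc₂.mono hs
    have hd₂ := hd₂.mono hs
    have hy₁c := hy₁c.mono hs
    have hy₂c := hy₂c.mono hs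
    have hyc := hyc.mono hs1
    constructor
    · refine aux_cmp h0 (a := a) (b := b) (c := c) (z := y) (x := y₁) (κ := γ₁ - y₁ t₀)
        (F := fun τ => (a₁ τ - a τ) * y₁ τ ^ 3 + (b₁ τ - b τ) * y₁ τ ^ 2 +
            (c₁ τ - c τ) * y₁ τ + (d₁ τ - d τ)) ha hb hc (by fun_prop) hyc hy₁c haneg''
        (hint T h0 hTτ) (fun t ht => ?_) (by linarith [hy0.1]) (fun t ht => hII t (hs ht))
      have h1 := ((hy t (hs1 ht)).mono hs1).sub ((hy₁ t (hs ht)).mono hs)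
      refine h1.congr_deriv ?_
      simp only [abelRHS]
      ring
    · refine aux_cmp h0 (a := a) (b := b) (c := c) (z := y₂) (x := y) (κ := y₂ t₀ - γ₂)
        (F := fun τ => -((a₂ τ - a τ) * y₂ τ ^ 3 + (b₂ τ - b τ) * y₂ τ ^ 2 +
            (c₂ τ - c τ) * y₂ τ + (d₂ τ - d τ))) ha hb hc (by fun_prop) hy₂c hyc haneg''
        (hint T h0 hTτ) (fun t ht => ?_) (by linarith [hy0.2]) (fun t ht => ?_)
      · have h1 := ((hy₂ t (hs ht)).mono hs).sub ((hy t (hs1 ht)).mono hs1)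
        refine h1.congr_deriv ?_
        simp only [abelRHS]
        ring
      · have := hIII t (hs ht)
        simp only [mul_neg, intervalIntegral.integral_neg]
        linarith
  have heq : t₁ = τ₀ := by
    by_contra hne
    have hlt : t₁ < τ₀ := lt_of_le_of_ne ht₁' hne
    lift t₁ to ℝ using ⟨hlt.ne_top, ht₁.ne_bot⟩ with r
    have h0 : t₀ < r := EReal.coe_lt_coe_iff.1 ht₁
    have hs : Icc t₀ r ⊆ eIco t₀ τ₀ := fun t ht =>
      ⟨ht.1, (EReal.coe_le_coe_iff.2 ht.2).trans_lt hlt⟩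
    obtain ⟨M₁, hM₁⟩ := isCompact_Icc.exists_bound_of_continuousOn (hy₁c.mono hs)
    obtain ⟨M₂, hM₂⟩ := isCompact_Icc.exists_bound_of_continuousOn (hy₂c.mono hs)
    refine aux_ext h0 hlt ha hb hc hd hy (M := max M₁ M₂) (fun t ht => ?_) hnc
    have hti : t ∈ Icc t₀ r := ⟨ht.1, (EReal.coe_lt_coe_iff.1 ht.2).le⟩
    have h1 := abs_le.1 (hM₁ t hti)
    have h2 := abs_le.1 (hM₂ t hti)
    have h3 := main t ht
    rw [abs_le]
    constructor
    · linarith [le_max_left M₁ M₂, h3.1.1]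
    · linarith [le_max_right M₁ M₂, h3.2.1]
  subst heq
  exact ⟨rfl, fun t ht => ⟨(main t ht).1.1, (main t ht).2.1⟩,
    fun h t ht => (main t ht).1.2 h, fun h t ht => (main t ht).2.2 h⟩
end

section
/- Assume: (1) a(t) > 0 for almost every t ∈ [t₀, T]; (2) the function t ↦ b(t)²/a(t) is Lebesgue integrable on [t₀, T]; (3) ∫_{t₀}^{T} [c(t) − b(t)²/(4a(t))] dt > 0; (4) d(t) ≤ 0 for all t ∈ [t₀, T]. Then the Abel equation (1.1) has a closed solution y on [t₀, T] with y(t) ≥ 0 for all t ∈ [t₀, T]. -/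
open Set MeasureTheory intervalIntegral

/-- truncated field -/
noncomputable def clampR (R y : ℝ) : ℝ := max 0 (min y R)

lemma clampR_nonneg (R y : ℝ) : 0 ≤ clampR R y := le_max_left _ _

lemma clampR_le {R : ℝ} (hR : 0 ≤ R) (y : ℝ) : clampR R y ≤ R := max_le hR (min_le_right _ _)

lemma clampR_eq {R y : ℝ} (h0 : 0 ≤ y) (hR : y ≤ R) : clampR R y = y := by
  unfold clampR
  rw [min_eq_left hR, max_eq_right h0]

lemma clampR_eq_zero {R y : ℝ} (h0 : y ≤ 0) : clampR R y = 0 :=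
  max_eq_left ((min_le_left _ _).trans h0)

lemma clampR_lip (R x y : ℝ) : |clampR R x - clampR R y| ≤ |x - y| := by
  unfold clampR
  refine (abs_max_sub_max_le_max _ _ _ _).trans ?_
  refine max_le (by simp) ?_
  exact (abs_min_sub_min_le_max _ _ _ _).trans (max_le le_rfl (by simp))

lemma exists_bound_Icc {f : ℝ → ℝ} (hf : Continuous f) (t₀ T : ℝ) :
    ∃ A : ℝ, 0 ≤ A ∧ ∀ t ∈ Icc t₀ T, |f t| ≤ A := by
  obtain ⟨A, hA⟩ := isCompact_Icc.exists_bound_of_continuousOn (s := Icc t₀ T) hf.continuousOn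
  exact ⟨|A|, abs_nonneg _, fun t ht => (hA t ht).trans (le_abs_self A)⟩

lemma field_bound {R A B C D a b c d p : ℝ} (hp : 0 ≤ p) (hpR : p ≤ R)
    (ha : |a| ≤ A) (hb : |b| ≤ B) (hc : |c| ≤ C) (hd : |d| ≤ D) :
    |-(a * p ^ 3 + b * p ^ 2 + c * p + d)| ≤ A * R ^ 3 + B * R ^ 2 + C * R + D := by
  have hA : 0 ≤ A := (abs_nonneg _).trans ha
  have hB : 0 ≤ B := (abs_nonneg _).trans hb
  have hC : 0 ≤ C := (abs_nonneg _).trans hc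
  have h1 : |a * p ^ 3| ≤ A * R ^ 3 := by
    rw [abs_mul, abs_of_nonneg (pow_nonneg hp 3)]; gcongr
  have h2 : |b * p ^ 2| ≤ B * R ^ 2 := by
    rw [abs_mul, abs_of_nonneg (pow_nonneg hp 2)]; gcongr
  have h3 : |c * p| ≤ C * R := by
    rw [abs_mul, abs_of_nonneg hp]; gcongr
  rw [abs_neg]
  rw [abs_le] at *
  constructor <;> linarith [h1.1, h1.2, h2.1, h2.2, h3.1, h3.2, hd.1, hd.2]

lemma field_lip {R A B C a b c d p q : ℝ} (hp : 0 ≤ p) (hpR : p ≤ R) (hq : 0 ≤ q) (hqR : q ≤ R)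
    (ha : |a| ≤ A) (hb : |b| ≤ B) (hc : |c| ≤ C) :
    |-(a * p ^ 3 + b * p ^ 2 + c * p + d) - -(a * q ^ 3 + b * q ^ 2 + c * q + d)|
      ≤ (A * (R ^ 2 + R * R + R ^ 2) + B * (R + R) + C) * |p - q| := by
  have hR : 0 ≤ R := hp.trans hpR
  have hA : 0 ≤ A := (abs_nonneg _).trans ha
  have hB : 0 ≤ B := (abs_nonneg _).trans hb
  have e : -(a * p ^ 3 + b * p ^ 2 + c * p + d) - -(a * q ^ 3 + b * q ^ 2 + c * q + d)
      = -((a * (p ^ 2 + p * q + q ^ 2) + b * (p + q) + c) * (p - q)) := by ring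
  rw [e, abs_neg, abs_mul]
  gcongr
  have h1 : |a * (p ^ 2 + p * q + q ^ 2)| ≤ A * (R ^ 2 + R * R + R ^ 2) := by
    rw [abs_mul, abs_of_nonneg (a := p ^ 2 + p * q + q ^ 2) (by positivity)]; gcongr
  have h2 : |b * (p + q)| ≤ B * (R + R) := by
    rw [abs_mul, abs_of_nonneg (a := p + q) (by positivity)]; gcongr
  rw [abs_le] at *
  constructor <;> linarith [h1.1, h1.2, h2.1, h2.2, hc.1, hc.2]

lemma exists_of_upper (t₀ T : ℝ) (hT : t₀ < T) (a b c d : ℝ → ℝ)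
    (ha : Continuous a) (hb : Continuous b) (hc : Continuous c) (hd : Continuous d)
    (h4 : ∀ t ∈ Icc t₀ T, d t ≤ 0) (R : ℝ) (z z' : ℝ → ℝ)
    (hz : ∀ t, HasDerivAt z (z' t) t)
    (hz0 : ∀ t ∈ Icc t₀ T, 0 ≤ z t) (hzR : ∀ t ∈ Icc t₀ T, z t ≤ R) (hzT : z T ≤ z t₀)
    (hup : ∀ t ∈ Icc t₀ T, abelRHS a b c d z t < z' t) :
    ∃ y : ℝ → ℝ, IsAbelSolOn a b c d y (Icc t₀ T) ∧ y t₀ = y T ∧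
      ∀ t ∈ Icc t₀ T, 0 ≤ y t := by
  have ht₀ : t₀ ∈ Icc t₀ T := left_mem_Icc.2 hT.le
  have hTm : T ∈ Icc t₀ T := right_mem_Icc.2 hT.le
  have hR : 0 ≤ R := (hz0 t₀ ht₀).trans (hzR t₀ ht₀)
  obtain ⟨A, hA0, hA⟩ := exists_bound_Icc ha t₀ T
  obtain ⟨B, hB0, hB⟩ := exists_bound_Icc hb t₀ T
  obtain ⟨C, hC0, hC⟩ := exists_bound_Icc hc t₀ T
  obtain ⟨D, hD0, hD⟩ := exists_bound_Icc hd t₀ T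
  set g : ℝ → ℝ → ℝ := fun t x =>
    -(a t * clampR R x ^ 3 + b t * clampR R x ^ 2 + c t * clampR R x + d t) with hg
  have hT0 : 0 ≤ T - t₀ := by linarith
  have hL0 : 0 ≤ A * R ^ 3 + B * R ^ 2 + C * R + D := by positivity
  have hK0 : 0 ≤ A * (R ^ 2 + R * R + R ^ 2) + B * (R + R) + C := by positivity
  have hM0 : 0 ≤ z t₀ := hz0 t₀ ht₀
  have hPL : IsPicardLindelof g (⟨t₀, ht₀⟩ : Icc t₀ T) (0 : ℝ)
      ⟨z t₀ + (A * R ^ 3 + B * R ^ 2 + C * R + D) * (T - t₀), by positivity⟩ ⟨z t₀, hM0⟩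
      ⟨_, hL0⟩ ⟨_, hK0⟩ := by
    refine ⟨?_, ?_, ?_, ?_⟩
    · intro t ht
      refine LipschitzOnWith.of_dist_le_mul fun x _ y _ => ?_
      rw [Real.dist_eq, Real.dist_eq]
      refine (field_lip (clampR_nonneg R x) (clampR_le hR x) (clampR_nonneg R y) (clampR_le hR y)
        (hA t ht) (hB t ht) (hC t ht)).trans ?_
      exact mul_le_mul_of_nonneg_left (clampR_lip R x y) hK0
    · intro x _
      apply Continuous.continuousOn
      simp only [hg]
      fun_prop
    · intro t ht x _
      rw [Real.norm_eq_abs]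
      exact field_bound (clampR_nonneg R x) (clampR_le hR x) (hA t ht) (hB t ht) (hC t ht) (hD t ht)
    · simp only [sub_self, max_eq_left hT0]
      change (A * R ^ 3 + B * R ^ 2 + C * R + D) * (T - t₀) ≤
        z t₀ + (A * R ^ 3 + B * R ^ 2 + C * R + D) * (T - t₀) - z t₀
      linarith
  obtain ⟨φ, hφ, L', hLip⟩ :=
    hPL.exists_forall_mem_closedBall_eq_hasDerivWithinAt_lipschitzOnWith
  have hball : Icc 0 (z t₀) ⊆ Metric.closedBall (0 : ℝ) (z t₀) := by
    intro x hx
    rw [Metric.mem_closedBall, Real.dist_eq, sub_zero, abs_of_nonneg hx.1]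
    exact hx.2
  have hder : ∀ x ∈ Icc 0 (z t₀), ∀ t ∈ Ico t₀ T,
      HasDerivWithinAt (φ x) (g t (φ x t)) (Ici t) t := by
    intro x hx t ht
    refine ((hφ x (hball hx)).2 t (Ico_subset_Icc_self ht)).mono_of_mem_nhdsWithin ?_
    exact mem_nhdsWithin.2 ⟨Iio T, isOpen_Iio, ht.2, fun s hs => ⟨ht.1.trans hs.2, hs.1.le⟩⟩
  have hcont : ∀ x ∈ Icc 0 (z t₀), ContinuousOn (φ x) (Icc t₀ T) := fun x hx t ht =>
    ((hφ x (hball hx)).2 t ht).continuousWithinAt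
  have hupper : ∀ x ∈ Icc 0 (z t₀), ∀ t ∈ Icc t₀ T, φ x t ≤ z t := by
    intro x hx
    have := image_le_of_deriv_right_lt_deriv_boundary (hcont x hx) (hder x hx) (B := z) (B' := z')
      (by rw [(hφ x (hball hx)).1]; exact hx.2) hz (by
        intro t ht he
        have ht' := Ico_subset_Icc_self ht
        have := hup t ht'
        simp only [hg, he, clampR_eq (hz0 t ht') (hzR t ht')]
        exact this)
    exact fun t ht => this ht
  have hlower : ∀ x ∈ Icc 0 (z t₀), ∀ t ∈ Icc t₀ T, 0 ≤ φ x t := by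
    intro x hx t ht
    have key : ∀ δ > 0, - φ x t ≤ δ * (1 + (t - t₀)) := by
      intro δ hδ
      refine image_le_of_deriv_right_lt_deriv_boundary (f := fun t => - φ x t)
        (f' := fun t => - g t (φ x t)) (B := fun t => δ * (1 + (t - t₀)))
        (B' := fun _ => δ) (hcont x hx).neg
        (fun t ht => (hder x hx t ht).neg) ?_ ?_ ?_ ht
      · have h1 := (hφ x (hball hx)).1
        have h2 := hx.1
        simp only at h1 ⊢
        rw [h1]; simp; linarith
      · intro s
        simpa using (((hasDerivAt_id s).sub_const t₀).const_add 1).const_mul δ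
      · intro s hs he
        have h1 : φ x s ≤ 0 := by
          have : 0 ≤ δ * (1 + (s - t₀)) := by
            have := hs.1
            apply mul_nonneg hδ.le; linarith
          linarith
        have h2 := h4 s (Ico_subset_Icc_self hs)
        simp only [hg, clampR_eq_zero h1]
        simp
        linarith
    by_contra hneg
    push Not at hneg
    have h1 : 0 < 1 + (t - t₀) := by linarith [ht.1]
    have := key (-φ x t / (2 * (1 + (t - t₀)))) (by apply div_pos <;> linarith)
    have e : -φ x t / (2 * (1 + (t - t₀))) * (1 + (t - t₀)) = - φ x t / 2 := by
      field_simp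
    linarith
  have hivt : ∃ x ∈ Icc 0 (z t₀), φ x T - x = 0 := by
    have hco : ContinuousOn (fun x => φ x T - x) (Icc 0 (z t₀)) :=
      ((hLip T hTm).continuousOn.mono hball).sub continuousOn_id
    have := intermediate_value_Icc' hM0 hco
    have h0 : (0 : ℝ) ∈ Icc (φ (z t₀) T - z t₀) (φ 0 T - 0) := by
      constructor
      · have := hupper (z t₀) ⟨hM0, le_rfl⟩ T hTm
        linarith
      · have := hlower 0 ⟨le_rfl, hM0⟩ T hTm
        linarith
    obtain ⟨x, hx, hx'⟩ := this h0
    exact ⟨x, hx, hx'⟩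
  obtain ⟨x, hx, hxT⟩ := hivt
  refine ⟨φ x, ?_, ?_, hlower x hx⟩
  · intro t ht
    have h1 := (hφ x (hball hx)).2 t ht
    have h2 : clampR R (φ x t) = φ x t :=
      clampR_eq (hlower x hx t ht) ((hupper x hx t ht).trans (hzR t ht))
    simp only [hg, h2] at h1
    exact h1
  · have h1 := (hφ x (hball hx)).1
    simp only at h1
    linarith

lemma core_exists (t₀ T : ℝ) (hT : t₀ < T) (a b c d h : ℝ → ℝ)
    (ha : Continuous a) (hb : Continuous b) (hc : Continuous c) (hd : Continuous d)
    (ha0 : ∀ t, 0 ≤ a t)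
    (h4 : ∀ t ∈ Icc t₀ T, d t ≤ 0) (hint : IntervalIntegrable h volume t₀ T)
    (hh : ∀ ε > 0, ∀ᵐ t ∂(volume.restrict (Icc t₀ T)), h t ≤ c t - b t ^ 2 / (4 * (a t + ε)))
    (hI : 0 < ∫ t in t₀..T, h t) :
    ∃ y : ℝ → ℝ, IsAbelSolOn a b c d y (Icc t₀ T) ∧ y t₀ = y T ∧
      ∀ t ∈ Icc t₀ T, 0 ≤ y t := by
  obtain ⟨D, hD0, hD⟩ := exists_bound_Icc hd t₀ T
  set I := ∫ t in t₀..T, h t with hIdef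
  set B := (∫ t in t₀..T, |h t|) + (∫ t in t₀..T, |c t|) + I / 2 with hB
  have hb1 : 0 ≤ ∫ t in t₀..T, |h t| := integral_nonneg hT.le fun _ _ => abs_nonneg _
  have hb2 : 0 ≤ ∫ t in t₀..T, |c t| := integral_nonneg hT.le fun _ _ => abs_nonneg _
  have hL : 0 < T - t₀ := by linarith
  set N := (D + 1) * (Real.exp B * (T - t₀)) with hN
  have hN0 : 0 ≤ N := by positivity
  have hq : 0 < 1 - Real.exp (-(I / 2)) := by
    have : Real.exp (-(I / 2)) < 1 := by
      rw [← Real.exp_zero]; exact Real.exp_lt_exp.2 (by linarith)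
    linarith
  set M := Real.exp B * N / (1 - Real.exp (-(I / 2))) with hM
  have hM0 : 0 ≤ M := by positivity
  have hMeq : M - Real.exp (-(I / 2)) * M = Real.exp B * N := by
    have : M * (1 - Real.exp (-(I / 2))) = Real.exp B * N := div_mul_cancel₀ _ hq.ne'
    linarith
  set R := Real.exp B * (M + N) with hR
  have hR0 : 0 ≤ R := by positivity
  set ε := I / (2 * (R ^ 2 + 1) * (T - t₀)) with hε
  have hε0 : 0 < ε := by positivity
  have hεR : ε * R ^ 2 * (T - t₀) ≤ I / 2 := by
    have : ε * (R ^ 2 + 1) * (T - t₀) = I / 2 := by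
      rw [hε]; field_simp
    nlinarith [mul_pos hε0 hL]
  set k : ℝ → ℝ := fun t => c t - b t ^ 2 / (4 * (a t + ε)) - ε * R ^ 2 with hk
  have hkc : Continuous k := by
    have : ∀ t, 4 * (a t + ε) ≠ 0 := fun t => by have := ha0 t; positivity
    fun_prop (disch := assumption)
  set K : ℝ → ℝ := fun t => ∫ s in t₀..t, k s with hK
  have hKd : ∀ t, HasDerivAt K (k t) t := fun t =>
    integral_hasDerivAt_right (hkc.intervalIntegrable _ _)
      (hkc.stronglyMeasurableAtFilter _ _) hkc.continuousAt
  have hsub : ∀ t ∈ Icc t₀ T, IntervalIntegrable h volume t₀ t := fun t ht =>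
    hint.mono_set (by
      rw [uIcc_of_le ht.1, uIcc_of_le hT.le]; exact Icc_subset_Icc_right ht.2)
  have hKlow : ∀ t ∈ Icc t₀ T, (∫ s in t₀..t, h s) - I / 2 ≤ K t := by
    intro t ht
    have h1 : ∫ s in t₀..t, (h s - ε * R ^ 2) ≤ K t := by
      refine integral_mono_ae_restrict ht.1 ((hsub t ht).sub (by simp))
        (hkc.intervalIntegrable _ _) ?_
      have := hh ε hε0
      have := ae_mono (Measure.restrict_mono (Icc_subset_Icc_right ht.2) le_rfl) this
      filter_upwards [this] with s hs
      simp only [hk]; linarith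
    rw [intervalIntegral.integral_sub (hsub t ht) (by simp), intervalIntegral.integral_const,
      smul_eq_mul] at h1
    have : (t - t₀) * (ε * R ^ 2) ≤ (T - t₀) * (ε * R ^ 2) := by
      have := ht.2
      gcongr
    linarith
  have hKB1 : ∀ t ∈ Icc t₀ T, -B ≤ K t := by
    intro t ht
    have h1 := hKlow t ht
    have h2 : |∫ s in t₀..t, h s| ≤ ∫ s in t₀..T, |h s| := by
      refine (abs_integral_le_integral_abs ht.1).trans ?_
      refine integral_mono_interval le_rfl ht.1 ht.2 ?_ hint.abs
      exact Filter.Eventually.of_forall fun _ => abs_nonneg _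
    have := (abs_le.1 h2).1
    linarith
  have hKB2 : ∀ t ∈ Icc t₀ T, K t ≤ B := by
    intro t ht
    have h1 : K t ≤ ∫ s in t₀..t, |c s| := by
      refine integral_mono_on ht.1 (hkc.intervalIntegrable _ _)
        (hc.abs.intervalIntegrable _ _) ?_
      intro s _
      have : 0 ≤ b s ^ 2 / (4 * (a s + ε)) := by have := ha0 s; positivity
      have := le_abs_self (c s)
      have : 0 ≤ ε * R ^ 2 := by positivity
      simp only [hk]; linarith
    have h2 : ∫ s in t₀..t, |c s| ≤ ∫ s in t₀..T, |c s| := by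
      refine integral_mono_interval le_rfl ht.1 ht.2 ?_ (hc.abs.intervalIntegrable _ _)
      exact Filter.Eventually.of_forall fun _ => abs_nonneg _
    linarith
  have hKT : I / 2 ≤ K T := by
    have := hKlow T (right_mem_Icc.2 hT.le)
    linarith
  have hKcont : Continuous K := continuous_iff_continuousAt.2 fun t => (hKd t).continuousAt
  have heK : Continuous fun s => Real.exp (K s) := Real.continuous_exp.comp hKcont
  set E : ℝ → ℝ := fun t => ∫ s in t₀..t, Real.exp (K s) with hE
  have hEd : ∀ t, HasDerivAt E (Real.exp (K t)) t := fun t =>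
    integral_hasDerivAt_right (heK.intervalIntegrable _ _)
      (heK.stronglyMeasurableAtFilter _ _) heK.continuousAt
  have hE0 : ∀ t ∈ Icc t₀ T, 0 ≤ E t := fun t ht =>
    integral_nonneg ht.1 fun _ _ => (Real.exp_pos _).le
  have hE1 : ∀ t ∈ Icc t₀ T, (D + 1) * E t ≤ N := by
    intro t ht
    have h1 : E t ≤ ∫ s in t₀..t, Real.exp B := by
      refine integral_mono_on ht.1 (heK.intervalIntegrable _ _) (by simp) ?_
      intro s hs
      exact Real.exp_le_exp.2 (hKB2 s ⟨hs.1, hs.2.trans ht.2⟩)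
    rw [intervalIntegral.integral_const, smul_eq_mul] at h1
    have h2 : (t - t₀) * Real.exp B ≤ Real.exp B * (T - t₀) := by
      rw [mul_comm]; have := ht.2; gcongr
    rw [hN]
    gcongr
    linarith
  set z : ℝ → ℝ := fun t => Real.exp (-K t) * (M + (D + 1) * E t) with hz
  have hz0 : ∀ t ∈ Icc t₀ T, 0 ≤ z t := by
    intro t ht
    have := hE0 t ht
    positivity
  have hzR : ∀ t ∈ Icc t₀ T, z t ≤ R := by
    intro t ht
    have h1 := hE0 t ht
    have h2 := hE1 t ht
    have h3 : Real.exp (-K t) ≤ Real.exp B := Real.exp_le_exp.2 (by linarith [hKB1 t ht])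
    simp only [hz, hR]
    gcongr
  have hzt0 : z t₀ = M := by simp [hz, hK, hE]
  refine exists_of_upper t₀ T hT a b c d ha hb hc hd h4 R z (fun t => -k t * z t + (D + 1))
    ?_ hz0 hzR ?_ ?_
  · intro t
    have := ((hKd t).neg.exp).mul (((hEd t).const_mul (D + 1)).const_add M)
    refine this.congr_deriv ?_
    have e : Real.exp (-K t) * Real.exp (K t) = 1 := by rw [← Real.exp_add]; simp
    simp only [hz, Pi.neg_apply]
    linear_combination (D + 1) * e
  · rw [hzt0]
    have hTm : T ∈ Icc t₀ T := right_mem_Icc.2 hT.le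
    have h1 : Real.exp (-K T) * M ≤ Real.exp (-(I / 2)) * M := by
      gcongr
    have h2 : Real.exp (-K T) * ((D + 1) * E T) ≤ Real.exp B * N := by
      have := hE0 T hTm
      have := hE1 T hTm
      have h3 : Real.exp (-K T) ≤ Real.exp B := Real.exp_le_exp.2 (by linarith [hKB1 T hTm])
      gcongr
    simp only [hz]
    linarith
  · intro t ht
    have hzz := hz0 t ht
    have hzr := hzR t ht
    have hdd := (abs_le.1 (hD t ht)).1
    have hae : 0 < a t + ε := by have := ha0 t; positivity
    have h1 : k t ≤ a t * z t ^ 2 + b t * z t + c t := by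
      have h2 : ε * z t ^ 2 ≤ ε * R ^ 2 := by gcongr
      have h3 : 0 ≤ (a t + ε) * (z t + b t / (2 * (a t + ε))) ^ 2 := by positivity
      have h5 : (a t + ε) * (z t + b t / (2 * (a t + ε))) ^ 2
          = (a t + ε) * z t ^ 2 + b t * z t + b t ^ 2 / (4 * (a t + ε)) := by
        field_simp; ring
      simp only [hk]
      linarith
    have h6 := mul_le_mul_of_nonneg_right h1 hzz
    unfold abelRHS
    linarith [h6, hdd]

/-- Theorem 5.1: existence of a nonnegative closed solution of the Abel equation (1.1) on
`[t₀, T]` when `a > 0` a.e., `b²/a` is integrable, `∫ (c - b²/(4a)) > 0` and `d ≤ 0`. -/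
theorem stmt_11 (t₀ T : ℝ) (hT : t₀ < T)
    (a b c d : ℝ → ℝ)
    (ha : ContinuousOn a (Icc t₀ T)) (hb : ContinuousOn b (Icc t₀ T))
    (hc : ContinuousOn c (Icc t₀ T)) (hd : ContinuousOn d (Icc t₀ T))
    (hapos : ∀ᵐ t ∂(volume.restrict (Icc t₀ T)), 0 < a t)
    (hint : IntegrableOn (fun t => b t ^ 2 / a t) (Icc t₀ T))
    (h3 : 0 < ∫ t in t₀..T, (c t - b t ^ 2 / (4 * a t)))
    (h4 : ∀ t ∈ Icc t₀ T, d t ≤ 0) :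
    ∃ y : ℝ → ℝ, IsAbelSolOn a b c d y (Icc t₀ T) ∧ y t₀ = y T ∧
      ∀ t ∈ Icc t₀ T, 0 ≤ y t := by
  classical
  have hsubm : ∀ {f : ℝ → ℝ}, ContinuousOn f (Icc t₀ T) →
      ∃ g : ℝ → ℝ, Continuous g ∧ (∀ t ∈ Icc t₀ T, g t = f t) ∧ ∀ t, ∃ s ∈ Icc t₀ T, g t = f s := by
    intro f hf
    refine ⟨IccExtend hT.le ((Icc t₀ T).domRestrict f), ?_, ?_, ?_⟩
    · exact (continuousOn_iff_continuous_domRestrict.1 hf).Icc_extend'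
    · intro t ht
      rw [IccExtend_of_mem _ _ ht]; rfl
    · intro t
      exact ⟨projIcc t₀ T hT.le t, Subtype.coe_prop _, rfl⟩
  obtain ⟨a', ha', hae, har⟩ := hsubm ha
  obtain ⟨b', hb', hbe, -⟩ := hsubm hb
  obtain ⟨c', hc', hce, -⟩ := hsubm hc
  obtain ⟨d', hd', hde, -⟩ := hsubm hd
  have ha0 : ∀ t ∈ Icc t₀ T, 0 ≤ a t := by
    have hEq : (fun t => max (a' t) 0) =ᵐ[volume.restrict (Icc t₀ T)] a' := by
      filter_upwards [hapos, ae_restrict_mem measurableSet_Icc] with t h1 h2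
      rw [hae t h2]; exact max_eq_left h1.le
    have := Measure.eqOn_Icc_of_ae_eq volume hT.ne hEq
      (ha'.max continuous_const).continuousOn ha'.continuousOn
    intro t ht
    have h1 := this ht
    simp only at h1
    rw [← hae t ht, ← h1]
    exact le_max_right _ _
  have hi : IntervalIntegrable (fun t => c t - b t ^ 2 / (4 * a t)) volume t₀ T := by
    apply IntervalIntegrable.sub
    · exact hc.intervalIntegrable_of_Icc hT.le
    · have : IntervalIntegrable (fun t => b t ^ 2 / a t) volume t₀ T := by
        rw [intervalIntegrable_iff_integrableOn_Icc_of_le hT.le]; exact hint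
      have := this.const_mul (1 / 4)
      refine this.congr ?_
      exact fun t _ => by
        rw [div_mul_div_comm, one_mul]
  obtain ⟨y, hy, hy1, hy2⟩ := core_exists t₀ T hT a' b' c' d' (fun t => c t - b t ^ 2 / (4 * a t))
    ha' hb' hc' hd' (fun t => by obtain ⟨s, hs, e⟩ := har t; rw [e]; exact ha0 s hs)
    (fun t ht => by rw [hde t ht]; exact h4 t ht) hi
    (by
      intro ε hε
      filter_upwards [hapos, ae_restrict_mem measurableSet_Icc] with t h1 h2
      rw [hae t h2, hbe t h2, hce t h2]
      gcongr
      linarith) h3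
  refine ⟨y, ?_, hy1, hy2⟩
  intro t ht
  have := hy t ht
  unfold abelRHS at this ⊢
  rwa [hae t ht, hbe t ht, hce t ht, hde t ht] at this
end

section
/- Assume: (1) a(t) < 0 for almost every t ∈ [t₀, T]; (2) the function t ↦ b(t)²/a(t) is Lebesgue integrable on [t₀, T]; (3) for all t ∈ [t₀, T], ∫_{t₀}^{t} exp(∫_{t₀}^{τ} [c(s) − b(s)²/a(s)] ds)·d(τ) dτ ≤ 0; (4) there is a differentiable function η : [t₀, T] → ℝ with η′(t) + a(t)η(t)³ + b(t)η(t)² + c(t)η(t) + d(t) ≥ 0 for all t ∈ [t₀, T] and η(t₀) ≥ η(T) > 0. Then the Abel equation (1.1) has a closed solution y on [t₀, T] with y(t) ≥ 0 for all t ∈ [t₀, T]. -/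
open Set MeasureTheory intervalIntegral

lemma aux_expAC {f : ℝ → ℝ} {s t : ℝ} (hf : AbsolutelyContinuousOnInterval f s t) :
    AbsolutelyContinuousOnInterval (fun x => Real.exp (f x)) s t := by
  obtain ⟨C, hC⟩ := hf.exists_bound
  have key : ∀ x ∈ uIcc s t, ∀ z ∈ uIcc s t,
      Real.exp (f x) - Real.exp (f z) ≤ Real.exp C * |f x - f z| := by
    intro x hx z hz
    have h1 : f x ≤ C := (le_abs_self _).trans (hC x hx)
    have h2 := Real.add_one_le_exp (f z - f x)
    have h3 : Real.exp (f z) = Real.exp (f x) * Real.exp (f z - f x) := by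
      rw [← Real.exp_add]; ring_nf
    have h4 := Real.exp_le_exp.2 h1
    have h5 := Real.exp_pos (f x)
    calc _ = Real.exp (f x) * (1 - Real.exp (f z - f x)) := by rw [h3]; ring
      _ ≤ Real.exp (f x) * |f x - f z| := by
          gcongr
          have := le_abs_self (f x - f z)
          linarith
      _ ≤ _ := by gcongr
  rw [absolutelyContinuousOnInterval_iff] at hf ⊢
  intro ε hε
  have hCp := Real.exp_pos C
  obtain ⟨δ, hδ, H⟩ := hf (ε / Real.exp C) (by positivity)
  refine ⟨δ, hδ, fun E hE hE2 => ?_⟩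
  have := H E hE hE2
  rw [lt_div_iff₀ hCp, Finset.sum_mul] at this
  refine lt_of_le_of_lt (Finset.sum_le_sum fun i hi => ?_) this
  have hm := hE.1 i hi
  rw [Real.dist_eq, Real.dist_eq, abs_le]
  have k1 := key _ hm.1 _ hm.2
  have k2 := key _ hm.2 _ hm.1
  rw [abs_sub_comm] at k2
  constructor <;> linarith

lemma aux_core (t₀ T : ℝ) (hT : t₀ ≤ T)
    (a b c d : ℝ → ℝ)
    (ha : ContinuousOn a (Icc t₀ T)) (hb : ContinuousOn b (Icc t₀ T))
    (hc : ContinuousOn c (Icc t₀ T)) (hd : ContinuousOn d (Icc t₀ T))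
    (haneg : ∀ᵐ t ∂(volume.restrict (Icc t₀ T)), a t < 0)
    (hint : IntegrableOn (fun t => b t ^ 2 / a t) (Icc t₀ T))
    (h3 : ∀ t ∈ Icc t₀ T,
      (∫ τ in t₀..t, Real.exp (∫ s in t₀..τ, (c s - b s ^ 2 / a s)) * d τ) ≤ 0)
    (y : ℝ → ℝ) (hy : IsAbelSolOn a b c d y (Icc t₀ T)) (hy0 : 0 ≤ y t₀) : 0 ≤ y T := by
  have hyc : ContinuousOn y (Icc t₀ T) := HasDerivWithinAt.continuousOn hy
  have huIcc : uIcc t₀ T = Icc t₀ T := uIcc_of_le hT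
  have hI : IntervalIntegrable (fun t => b t ^ 2 / a t) volume t₀ T := by
    rw [intervalIntegrable_iff_integrableOn_Icc_of_le hT]; exact hint
  have mk : ∀ f : ℝ → ℝ, ContinuousOn f (Icc t₀ T) → IntervalIntegrable f volume t₀ T := by
    intro f hf; apply ContinuousOn.intervalIntegrable; rwa [huIcc]
  have hk : IntervalIntegrable (fun s => c s - b s ^ 2 / a s) volume t₀ T := (mk c hc).sub hI
  set q : ℝ → ℝ := fun s => -(a s * y s ^ 2 + b s * y s) - b s ^ 2 / a s with hqdef
  have hq : IntervalIntegrable q volume t₀ T := (mk _ (by fun_prop)).sub hI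
  have hmem : t₀ ∈ uIcc t₀ T := left_mem_uIcc
  have hKac := hk.absolutelyContinuousOnInterval_intervalIntegral hmem
  have hQac := hq.absolutelyContinuousOnInterval_intervalIntegral hmem
  have hPac := aux_expAC hKac
  have hRac := aux_expAC hQac.fun_neg
  have hPc := hPac.continuousOn
  rw [huIcc] at hPc
  have hpd := mk _ (hPc.mul hd)
  have hDac := hpd.absolutelyContinuousOnInterval_intervalIntegral hmem
  have hrhs : ContinuousOn (abelRHS a b c d y) (Icc t₀ T) := by
    unfold abelRHS; fun_prop
  have hyac : AbsolutelyContinuousOnInterval y t₀ T := by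
    obtain ⟨C, hC⟩ := isCompact_Icc.exists_bound_of_continuousOn hrhs
    have : LipschitzOnWith (Real.toNNReal C) y (uIcc t₀ T) := by
      rw [huIcc]
      refine Convex.lipschitzOnWith_of_nnnorm_hasDerivWithin_le (convex_Icc _ _) hy ?_
      intro x hx
      have := hC x hx
      rw [← NNReal.coe_le_coe, coe_nnnorm]
      exact this.trans (Real.le_coe_toNNReal C)
    exact this.absolutelyContinuousOnInterval
  have hGac := hRac.fun_mul ((hPac.fun_mul hyac).fun_add hDac)
  have hFTC := hGac.integral_deriv_eq_sub
  suffices hae : 0 ≤ᵐ[volume.restrict (Icc t₀ T)] (deriv (fun i =>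
      Real.exp (-∫ (v : ℝ) in t₀..i, q v) *
        (Real.exp (∫ (v : ℝ) in t₀..i, c v - b v ^ 2 / a v) * y i +
          ∫ (v : ℝ) in t₀..i,
            ((fun x => Real.exp (∫ (v : ℝ) in t₀..x, c v - b v ^ 2 / a v)) * d) v))) by
    have hnn := intervalIntegral.integral_nonneg_of_ae_restrict (μ := volume) hT hae
    rw [hFTC] at hnn
    simp only [intervalIntegral.integral_same, neg_zero, Real.exp_zero] at hnn
    have hDT := h3 T ⟨hT, le_rfl⟩
    simp only [Pi.mul_apply] at hnn
    have e1 := Real.exp_pos (-∫ v in t₀..T, q v)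
    have e2 := Real.exp_pos (∫ v in t₀..T, c v - b v ^ 2 / a v)
    by_contra! hneg
    have n1 := mul_neg_of_pos_of_neg e2 hneg
    have n2 := mul_neg_of_pos_of_neg e1 (add_neg_of_neg_of_nonpos n1 hDT)
    linarith
  · have hne1 : ∀ᵐ x : ℝ, x ≠ t₀ := by simp [ae_iff, measure_singleton]
    have hne2 : ∀ᵐ x : ℝ, x ≠ T := by simp [ae_iff, measure_singleton]
    rw [Filter.EventuallyLE]
    rw [ae_restrict_iff' measurableSet_Icc] at haneg ⊢
    filter_upwards [haneg, hne1, hne2, hk.ae_hasDerivAt_integral, hq.ae_hasDerivAt_integral,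
      hpd.ae_hasDerivAt_integral] with x hax hx1 hx2 hK hQ hD hx
    rw [← huIcc] at hx
    have hK := hK hx t₀ hmem
    have hQ := hQ hx t₀ hmem
    have hD := hD hx t₀ hmem
    rw [huIcc] at hx
    have hax := hax hx
    have hyx : HasDerivAt y _ x := (hy x hx).hasDerivAt
      (Icc_mem_nhds (lt_of_le_of_ne hx.1 (Ne.symm hx1)) (lt_of_le_of_ne hx.2 hx2))
    have hG := hQ.fun_neg.exp.fun_mul ((hK.exp.fun_mul hyx).fun_add hD)
    rw [hG.deriv]
    have hDx := h3 x hx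
    have hqx : 0 ≤ q x := by
      have : q x = (-a x) * ((y x + b x / a x / 2) ^ 2 + 3 / 4 * (b x / a x) ^ 2) := by
        have hax0 : a x ≠ 0 := hax.ne
        simp only [hqdef]
        field_simp
        ring
      rw [this]
      have : 0 < -a x := by linarith
      positivity
    have e1 := Real.exp_pos (-∫ v in t₀..x, q v)
    have := mul_nonneg e1.le (mul_nonneg hqx (neg_nonneg.2 hDx))
    change (0 : ℝ) ≤ _
    refine this.trans_eq ?_
    simp only [Pi.mul_apply, abelRHS]
    have hqe : q x = -(a x * y x ^ 2 + b x * y x) - b x ^ 2 / a x := rfl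
    rw [hqe]
    ring

lemma aux_compare (t₀ T K : ℝ) (f : ℝ → ℝ → ℝ) (y y' η η' : ℝ → ℝ)
    (hf : ∀ t ∈ Icc t₀ T, ∀ u v, |f t u - f t v| ≤ K * |u - v|)
    (hy : ∀ t ∈ Icc t₀ T, HasDerivWithinAt y (f t (y t)) (Icc t₀ T) t)
    (hη : ∀ t ∈ Icc t₀ T, HasDerivWithinAt η (η' t) (Icc t₀ T) t)
    (hη' : ∀ t ∈ Icc t₀ T, f t (η t) ≤ η' t) (h0 : y t₀ ≤ η t₀) :
    ∀ t ∈ Icc t₀ T, y t ≤ η t := by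
  have main : ∀ ε > 0, ∀ t ∈ Icc t₀ T, y t ≤ η t + ε * Real.exp ((K + 1) * (t - t₀)) := by
    intro ε hε
    have hright : ∀ {g : ℝ → ℝ} {g' x : ℝ}, x ∈ Ico t₀ T →
        HasDerivWithinAt g g' (Icc t₀ T) x → HasDerivWithinAt g g' (Ici x) x := by
      intro g g' x hx hg
      exact hg.mono_of_mem_nhdsWithin (Icc_mem_nhdsGE_of_mem hx)
    have hE : ∀ x, HasDerivAt (fun t => ε * Real.exp ((K + 1) * (t - t₀)))
        (ε * (Real.exp ((K + 1) * (x - t₀)) * ((K + 1) * 1))) x := by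
      intro x
      exact ((((hasDerivAt_id x).sub_const t₀).const_mul (K + 1)).exp).const_mul ε
    refine image_le_of_deriv_right_lt_deriv_boundary' (f' := fun t => f t (y t))
      (B' := fun t => η' t + ε * (Real.exp ((K + 1) * (t - t₀)) * ((K + 1) * 1)))
      (HasDerivWithinAt.continuousOn hy)
      (fun x hx => hright hx (hy x (Ico_subset_Icc_self hx))) ?_ ?_ ?_ ?_
    · simp; linarith
    · exact (HasDerivWithinAt.continuousOn hη).add (by fun_prop)
    · intro x hx
      exact (hright hx (hη x (Ico_subset_Icc_self hx))).fun_add (hE x).hasDerivWithinAt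
    · intro x hx he
      have hx' := Ico_subset_Icc_self hx
      have h1 := hf x hx' (y x) (η x)
      have h2 := hη' x hx'
      have hp : 0 < ε * Real.exp ((K + 1) * (x - t₀)) := by positivity
      have h4 : |y x - η x| = ε * Real.exp ((K + 1) * (x - t₀)) := by
        rw [he, add_sub_cancel_left, abs_of_pos hp]
      rw [h4] at h1
      have h5 := le_abs_self (f x (y x) - f x (η x))
      nlinarith
  intro t ht
  refine le_of_forall_pos_le_add fun δ hδ => ?_
  have hp := Real.exp_pos ((K + 1) * (t - t₀))
  have := main (δ / Real.exp ((K + 1) * (t - t₀))) (by positivity) t ht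
  rwa [div_mul_cancel₀ _ hp.ne'] at this

/-- truncation to `[-M, M]`. -/
noncomputable def auxP (M y : ℝ) : ℝ := max (-M) (min M y)

lemma auxP_bound {M : ℝ} (hM : 0 ≤ M) (y : ℝ) : |auxP M y| ≤ M := by
  unfold auxP; rw [abs_le]; constructor <;> grind

lemma auxP_eq {M y : ℝ} (h1 : -M ≤ y) (h2 : y ≤ M) : auxP M y = y := by
  unfold auxP; grind

lemma auxP_lip (M u v : ℝ) : |auxP M u - auxP M v| ≤ |u - v| := by
  unfold auxP
  refine (abs_max_sub_max_le_max _ _ _ _).trans ?_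
  simp only [sub_self, abs_zero, abs_nonneg, sup_of_le_right]
  refine (abs_min_sub_min_le_max _ _ _ _).trans ?_
  simp

/-- truncated right-hand side. -/
noncomputable def auxF (a b c d : ℝ → ℝ) (M t y : ℝ) : ℝ :=
  -(a t * auxP M y ^ 3 + b t * auxP M y ^ 2 + c t * auxP M y + d t)

lemma auxF_bound {a b c d : ℝ → ℝ} {M A t : ℝ} (hM : 0 ≤ M) (hat : |a t| ≤ A) (hbt : |b t| ≤ A)
    (hct : |c t| ≤ A) (hdt : |d t| ≤ A) (y : ℝ) :
    |auxF a b c d M t y| ≤ A * M ^ 3 + A * M ^ 2 + A * M + A := by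
  have hp := auxP_bound hM y
  have hA : 0 ≤ A := (abs_nonneg _).trans hat
  unfold auxF
  rw [abs_neg]
  refine (abs_add_le _ _).trans (add_le_add ((abs_add_le _ _).trans (add_le_add
    ((abs_add_le _ _).trans (add_le_add ?_ ?_)) ?_)) hdt)
  all_goals
    simp only [abs_mul, abs_pow]
    gcongr

lemma auxF_lip {a b c d : ℝ → ℝ} {M A t : ℝ} (hM : 0 ≤ M) (hat : |a t| ≤ A) (hbt : |b t| ≤ A)
    (hct : |c t| ≤ A) (u v : ℝ) :
    |auxF a b c d M t u - auxF a b c d M t v| ≤ (A * (M ^ 2 + M * M + M ^ 2) + A * (M + M) + A) * |u - v| := by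
  have hp := auxP_bound hM u
  have hq := auxP_bound hM v
  have hA : 0 ≤ A := (abs_nonneg _).trans hat
  have hl := auxP_lip M u v
  unfold auxF
  set p := auxP M u
  set r := auxP M v
  have : -(a t * p ^ 3 + b t * p ^ 2 + c t * p + d t) - -(a t * r ^ 3 + b t * r ^ 2 + c t * r + d t)
    = -((a t * (p ^ 2 + p * r + r ^ 2) + b t * (p + r) + c t) * (p - r)) := by ring
  rw [this, abs_neg, abs_mul]
  gcongr
  refine (abs_add_le _ _).trans (add_le_add ((abs_add_le _ _).trans (add_le_add ?_ ?_)) hct)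
  · rw [abs_mul]
    gcongr
    refine (abs_add_le _ _).trans (add_le_add ((abs_add_le _ _).trans (add_le_add ?_ ?_)) ?_)
    all_goals
      simp only [abs_mul, abs_pow]
      gcongr
  · rw [abs_mul]
    gcongr
    exact (abs_add_le _ _).trans (add_le_add hp hq)

/-- Theorem 5.3: existence of a nonnegative closed solution of the Abel equation (1.1) on
`[t₀, T]` when `a < 0` a.e., `b²/a` is integrable, the weighted integral of `d` is ≤ 0,
and (2.4) has a supersolution `η` with `η t₀ ≥ η T > 0`. -/
theorem stmt_13 (t₀ T : ℝ) (hT : t₀ < T)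
    (a b c d : ℝ → ℝ)
    (ha : ContinuousOn a (Icc t₀ T)) (hb : ContinuousOn b (Icc t₀ T))
    (hc : ContinuousOn c (Icc t₀ T)) (hd : ContinuousOn d (Icc t₀ T))
    (haneg : ∀ᵐ t ∂(volume.restrict (Icc t₀ T)), a t < 0)
    (hint : IntegrableOn (fun t => b t ^ 2 / a t) (Icc t₀ T))
    (h3 : ∀ t ∈ Icc t₀ T,
      (∫ τ in t₀..t, Real.exp (∫ s in t₀..τ, (c s - b s ^ 2 / a s)) * d τ) ≤ 0)
    (η : ℝ → ℝ)
    (hη : ∀ t ∈ Icc t₀ T, ∃ v : ℝ, HasDerivWithinAt η v (Icc t₀ T) t ∧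
      0 ≤ v + a t * η t ^ 3 + b t * η t ^ 2 + c t * η t + d t)
    (hη1 : η T ≤ η t₀) (hη2 : 0 < η T) :
    ∃ y : ℝ → ℝ, IsAbelSolOn a b c d y (Icc t₀ T) ∧ y t₀ = y T ∧
      ∀ t ∈ Icc t₀ T, 0 ≤ y t := by
  have hle := hT.le
  have hηc : ContinuousOn η (Icc t₀ T) := fun t ht => by
    obtain ⟨v, hv, _⟩ := hη t ht
    exact hv.continuousWithinAt
  obtain ⟨M, hM⟩ := isCompact_Icc.exists_bound_of_continuousOn hηc
  obtain ⟨A1, hA1⟩ := isCompact_Icc.exists_bound_of_continuousOn ha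
  obtain ⟨A2, hA2⟩ := isCompact_Icc.exists_bound_of_continuousOn hb
  obtain ⟨A3, hA3⟩ := isCompact_Icc.exists_bound_of_continuousOn hc
  obtain ⟨A4, hA4⟩ := isCompact_Icc.exists_bound_of_continuousOn hd
  simp only [Real.norm_eq_abs] at hM hA1 hA2 hA3 hA4
  obtain ⟨A, h1, h2, h3', h4⟩ : ∃ A, A1 ≤ A ∧ A2 ≤ A ∧ A3 ≤ A ∧ A4 ≤ A :=
    ⟨max (max A1 A2) (max A3 A4), by simp, by simp, by simp, by simp⟩
  replace hA1 := fun t ht => (hA1 t ht).trans h1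
  replace hA2 := fun t ht => (hA2 t ht).trans h2
  replace hA3 := fun t ht => (hA3 t ht).trans h3'
  replace hA4 := fun t ht => (hA4 t ht).trans h4
  have ht0 : t₀ ∈ Icc t₀ T := ⟨le_rfl, hle⟩
  have htT : T ∈ Icc t₀ T := ⟨hle, le_rfl⟩
  have hη0 : 0 < η t₀ := hη2.trans_le hη1
  have hMpos : 0 < M := by
    have := hM t₀ ht0
    rw [abs_of_pos hη0] at this
    linarith
  have hA0 : 0 ≤ A := (abs_nonneg _).trans (hA1 t₀ ht0)
  set F := auxF a b c d M with hF
  set K := A * (M ^ 2 + M * M + M ^ 2) + A * (M + M) + A with hK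
  set L := A * M ^ 3 + A * M ^ 2 + A * M + A with hL
  have hK0 : 0 ≤ K := by positivity
  have hL0 : 0 ≤ L := by positivity
  have hT0 : 0 ≤ T - t₀ := by linarith
  have hFl : ∀ t ∈ Icc t₀ T, ∀ u v, |F t u - F t v| ≤ K * |u - v| := fun t ht u v =>
    auxF_lip hMpos.le (hA1 t ht) (hA2 t ht) (hA3 t ht) u v
  have hPL : IsPicardLindelof F (⟨t₀, ht0⟩ : Icc t₀ T) (0 : ℝ)
      ⟨η t₀ + L * (T - t₀), by positivity⟩ ⟨η t₀, hη0.le⟩ ⟨L, hL0⟩ ⟨K, hK0⟩ := by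
    refine ⟨fun t ht => ?_, fun x _ => ?_, fun t ht x _ => ?_, ?_⟩
    · exact LipschitzOnWith.of_dist_le_mul fun u _ v _ => hFl t ht u v
    · simp only [hF, auxF]
      fun_prop
    · exact auxF_bound hMpos.le (hA1 t ht) (hA2 t ht) (hA3 t ht) (hA4 t ht) x
    · simp only [sub_self, max_eq_left hT0]
      change L * (T - t₀) ≤ η t₀ + L * (T - t₀) - η t₀
      linarith
  obtain ⟨α, hα, L', hL'⟩ :=
    hPL.exists_forall_mem_closedBall_eq_hasDerivWithinAt_lipschitzOnWith
  have hsub : ∀ x ∈ Icc 0 (η t₀), x ∈ Metric.closedBall (0 : ℝ) (η t₀) := by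
    intro x hx
    simp only [Metric.mem_closedBall, dist_zero_right, Real.norm_eq_abs]
    rw [abs_of_nonneg hx.1]; exact hx.2
  have hαs : ∀ x ∈ Icc 0 (η t₀), α x t₀ = x ∧
      ∀ t ∈ Icc t₀ T, HasDerivWithinAt (α x) (F t (α x t)) (Icc t₀ T) t := fun x hx =>
    hα x (hsub x hx)
  have hgc : ContinuousOn (fun x => α x T) (Icc 0 (η t₀)) :=
    ((hL' T htT).continuousOn).mono hsub
  choose! η' hη'd hη'i using hη
  have hup : ∀ x ∈ Icc 0 (η t₀), ∀ t ∈ Icc t₀ T, α x t ≤ η t := by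
    intro x hx
    refine aux_compare t₀ T K F (α x) (η') η η' hFl (hαs x hx).2 hη'd ?_ ?_
    · intro t ht
      have hb := abs_le.1 (hM t ht)
      have := hη'i t ht
      simp only [hF, auxF, auxP_eq hb.1 hb.2]
      linarith
    · rw [(hαs x hx).1]; exact hx.2
  have hupM : ∀ x ∈ Icc 0 (η t₀), ∀ t ∈ Icc t₀ T, α x t ≤ M := fun x hx t ht =>
    (hup x hx t ht).trans (abs_le.1 (hM t ht)).2
  have hreal : ∀ x ∈ Icc 0 (η t₀), ∀ s ∈ Icc t₀ T, (∀ t ∈ Icc t₀ s, -M ≤ α x t) →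
      IsAbelSolOn a b c d (α x) (Icc t₀ s) := by
    intro x hx s hs hlow t ht
    have ht' : t ∈ Icc t₀ T := ⟨ht.1, ht.2.trans hs.2⟩
    have h := ((hαs x hx).2 t ht').mono (Icc_subset_Icc_right hs.2)
    simp only [hF, auxF, auxP_eq (hlow t ht) (hupM x hx t ht')] at h
    exact h
  have hlow : ∀ x ∈ Icc 0 (η t₀), ∀ t ∈ Icc t₀ T, 0 ≤ α x t := by
    intro x hx t ht
    by_contra! hneg
    set m := max (α x t) (-M) with hm
    have hm0 : m < 0 := max_lt hneg (by linarith)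
    have hcont : ContinuousOn (α x) (Icc t₀ T) := HasDerivWithinAt.continuousOn (hαs x hx).2
    have hcl : IsCompact (Icc t₀ T ∩ α x ⁻¹' Iic m) :=
      isCompact_Icc.of_isClosed_subset
        (hcont.preimage_isClosed_of_isClosed isClosed_Icc isClosed_Iic) inter_subset_left
    obtain ⟨s, ⟨hs, hsm⟩, hleast⟩ := hcl.exists_isLeast ⟨t, ht, (le_max_left _ _ : α x t ≤ m)⟩
    have hlt : ∀ r ∈ Icc t₀ T, r < s → -M < α x r := by
      intro r hr hrs
      by_contra! hcon
      have := hleast ⟨hr, (hcon.trans (le_max_right _ _) : α x r ≤ m)⟩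
      linarith
    have hs0 : t₀ < s := by
      refine lt_of_le_of_ne hs.1 fun he => ?_
      have h5 : α x s ≤ m := hsm
      rw [← he, (hαs x hx).1] at h5
      linarith [hx.1]
    have hsM : -M ≤ α x s := by
      have hcw : ContinuousWithinAt (α x) (Ico t₀ s) s :=
        (hcont s hs).mono fun r hr => ⟨hr.1, hr.2.le.trans hs.2⟩
      have hcl2 : s ∈ closure (Ico t₀ s) := by
        rw [closure_Ico hs0.ne]; exact ⟨hs0.le, le_rfl⟩
      exact continuousWithinAt_const.closure_le hcl2 hcw
        fun r hr => (hlt r ⟨hr.1, hr.2.le.trans hs.2⟩ hr.2).le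
    have hss : Icc t₀ s ⊆ Icc t₀ T := Icc_subset_Icc_right hs.2
    have hsol := hreal x hx s hs fun r hr => by
      rcases hr.2.eq_or_lt with h | h
      · rw [h]; exact hsM
      · exact (hlt r (hss hr) h).le
    have hfin := aux_core t₀ s hs.1 a b c d (ha.mono hss) (hb.mono hss) (hc.mono hss)
      (hd.mono hss) (ae_restrict_of_ae_restrict_of_subset hss haneg) (hint.mono_set hss)
      (fun r hr => h3 r (hss hr)) (α x) hsol (by rw [(hαs x hx).1]; exact hx.1)
    have h5 : α x s ≤ m := hsm
    linarith
  have h0mem : (0 : ℝ) ∈ Icc 0 (η t₀) := ⟨le_rfl, hη0.le⟩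
  have h1mem : η t₀ ∈ Icc 0 (η t₀) := ⟨hη0.le, le_rfl⟩
  have hivt := intermediate_value_Icc' hη0.le (hgc.sub continuousOn_id)
  obtain ⟨x, hx, hxe⟩ := hivt (show (0 : ℝ) ∈ Icc _ _ from
    ⟨by have := hup _ h1mem T htT; simp only [Pi.sub_apply, id]; linarith,
     by have := hlow _ h0mem T htT; simp only [Pi.sub_apply, id]; linarith⟩)
  refine ⟨α x, ?_, ?_, hlow x hx⟩
  · exact hreal x hx T htT fun t ht => by linarith [hlow x hx t ht]
  · simp only [Pi.sub_apply, id] at hxe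
    rw [(hαs x hx).1]; linarith
end

section
/- Let y₁ and y₂ be solutions of equations (2.1) and (3.10) respectively on [t₀, T] such that y₁(t₀) ≤ y₂(t₀), y₁(t₀) ≤ y₁(T), and y₂(t₀) ≥ y₂(T). Assume: (i) a(t) < 0 for almost every t ∈ [t₀, T] and b²/a is Lebesgue integrable on [t₀, T]; (ii) there exists γ₁ ∈ [y₁(t₀), y₂(t₀)] such that for all t ∈ [t₀, T], γ₁ − y₁(t₀) + ∫_{t₀}^{t} exp(∫_{t₀}^{τ} [c(s) − b(s)²/a(s)] ds)·[(a₁(τ) − a(τ))y₁(τ)³ + (b₁(τ) − b(τ))y₁(τ)² + (c₁(τ) − c(τ))y₁(τ) + d₁(τ) − d(τ)] dτ ≥ 0; (iii) there exists γ₂ ∈ [γ₁, y₂(t₀)] such that for all t ∈ [t₀, T], γ₂ − y₂(t₀) + ∫_{t₀}^{t} exp(∫_{t₀}^{τ} [c(s) − b(s)²/a(s)] ds)·[(a₂(τ) − a(τ))y₂(τ)³ + (b₂(τ) − b(τ))y₂(τ)² + (c₂(τ) − c(τ))y₂(τ) + d₂(τ) − d(τ)] dτ ≤ 0. Then the Abel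 equation (1.1) has a closed solution on [t₀, T]. -/
open Set MeasureTheory intervalIntegral

/-- Integral inequality when the derivative bound holds only almost everywhere. -/
lemma int_le_sub_ae {p q : ℝ} (hpq : p ≤ q) {g g' φ : ℝ → ℝ}
    (hderiv : ∀ x ∈ Icc p q, HasDerivWithinAt g (g' x) (Icc p q) x)
    (φint : IntegrableOn φ (Icc p q))
    (hae : ∀ᵐ x ∂(volume.restrict (Icc p q)), φ x ≤ g' x) :
    (∫ x in p..q, φ x) ≤ g q - g p := by
  have hcongr : φ =ᵐ[volume.restrict (Icc p q)] fun x => min (φ x) (g' x) := by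
    filter_upwards [hae] with x hx
    rw [min_eq_left hx]
  have hint : IntegrableOn (fun x => min (φ x) (g' x)) (Icc p q) := φint.congr hcongr
  have h := intervalIntegral.integral_le_sub_of_hasDeriv_right_of_le (g := g) (g' := g')
    (φ := fun x => min (φ x) (g' x)) hpq
    (fun x hx => (hderiv x hx).continuousWithinAt)
    (fun x hx => ((hderiv x ⟨hx.1.le, hx.2.le⟩).hasDerivAt
      (Icc_mem_nhds hx.1 hx.2)).hasDerivWithinAt) hint (fun x _ => min_le_right _ _)
  refine le_trans (le_of_eq ?_) h
  rw [intervalIntegral.integral_of_le hpq, intervalIntegral.integral_of_le hpq,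
    ← integral_Icc_eq_integral_Ioc, ← integral_Icc_eq_integral_Ioc]
  exact integral_congr_ae hcongr

lemma abel_pt (a b c d x : ℝ) (ha : a < 0) :
    x * (a * x ^ 3 + b * x ^ 2 + c * x + d) ≤
      a / 2 * x ^ 4 + (|b ^ 2 / a| + |c| + |d|) * (1 + x ^ 2) := by
  have h1 : |b ^ 2 / a| = b ^ 2 / (-a) := by
    rw [abs_div, abs_of_neg ha, abs_of_nonneg (sq_nonneg b)]
  obtain ⟨e, he⟩ : ∃ e, b = a * e := ⟨b / a, by rw [mul_div_assoc', mul_comm, mul_div_assoc, div_self ha.ne, mul_one]⟩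
  have h2 : |b ^ 2 / a| = -a * e ^ 2 := by
    rw [h1, he]; field_simp
  rw [h2, he]
  have h3 : c * x ^ 2 ≤ |c| * (1 + x ^ 2) := by
    nlinarith [le_abs_self c, sq_nonneg x, abs_nonneg c]
  have h4 : d * x ≤ |d| * (1 + x ^ 2) := by
    have : |x| ≤ 1 + x ^ 2 := by nlinarith [sq_abs x, sq_nonneg (|x| - 1), sq_nonneg x]
    calc d * x ≤ |d * x| := le_abs_self _
      _ = |d| * |x| := abs_mul _ _
      _ ≤ _ := by gcongr
  have h5 : 0 ≤ -a * (x ^ 2 * (x + e) ^ 2 + e ^ 2 * x ^ 2 + 2 * e ^ 2) := by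
    have : 0 ≤ -a := by linarith
    positivity
  nlinarith

/-- Truncation to `[-K, K]`. -/
noncomputable def clampK (K x : ℝ) : ℝ := max (min x K) (-K)

lemma clampK_abs {K : ℝ} (hK : 0 ≤ K) (x : ℝ) : |clampK K x| ≤ K := by
  unfold clampK
  rw [abs_le]
  exact ⟨le_max_right _ _, max_le (min_le_right _ _) (by linarith)⟩

lemma clampK_eq {K x : ℝ} (hx : |x| ≤ K) : clampK K x = x := by
  unfold clampK
  rw [abs_le] at hx
  rw [min_eq_left hx.2, max_eq_left hx.1]

lemma clampK_lip (K x y : ℝ) : |clampK K x - clampK K y| ≤ |x - y| := by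
  unfold clampK
  refine (abs_max_sub_max_le_abs _ _ _).trans ?_
  refine (abs_min_sub_min_le_max _ _ _ _).trans ?_
  simp

lemma abel_pt_clamp (a b c d x K : ℝ) (ha : a < 0) (hK : 1 ≤ K) :
    x * (a * clampK K x ^ 3 + b * clampK K x ^ 2 + c * clampK K x + d) ≤
      (|b ^ 2 / a| + |c| + |d|) * (1 + x ^ 2) := by
  have key : ∀ y : ℝ, y * (a * y ^ 3 + b * y ^ 2 + c * y + d) ≤
      (|b ^ 2 / a| + |c| + |d|) * (1 + y ^ 2) := fun y => by
    have := abel_pt a b c d y ha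
    have h : a / 2 * y ^ 4 ≤ 0 := mul_nonpos_of_nonpos_of_nonneg (by linarith) (by positivity)
    linarith
  have hm : 0 ≤ |b ^ 2 / a| + |c| + |d| := by positivity
  generalize |b ^ 2 / a| + |c| + |d| = m at *
  have gen : ∀ y l : ℝ, 1 ≤ l → 1 ≤ y ^ 2 → x = l * y →
      x * (a * y ^ 3 + b * y ^ 2 + c * y + d) ≤ m * (1 + x ^ 2) := by
    intro y l hl hy hx
    calc x * (a * y ^ 3 + b * y ^ 2 + c * y + d)
        = l * (y * (a * y ^ 3 + b * y ^ 2 + c * y + d)) := by rw [hx]; ring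
      _ ≤ l * (m * (1 + y ^ 2)) := mul_le_mul_of_nonneg_left (key y) (by linarith)
      _ = m * (l * (1 + y ^ 2)) := by ring
      _ ≤ m * (1 + x ^ 2) := by
        gcongr
        rw [hx]
        nlinarith [mul_nonneg (sub_nonneg.2 hl) (sub_nonneg.2 hy),
          mul_nonneg (mul_nonneg (sub_nonneg.2 hl) (sub_nonneg.2 hl)) (sub_nonneg.2 hy),
          mul_nonneg (sub_nonneg.2 hl) (sub_nonneg.2 hl)]
  have hK0 : K ≠ 0 := by linarith
  rcases le_or_gt |x| K with h | h
  · rw [clampK_eq h]; exact key x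
  · rcases lt_abs.1 h with h | h
    · have : clampK K x = K := by
        unfold clampK
        rw [min_eq_right h.le, max_eq_left (by linarith)]
      rw [this]
      exact gen K (x / K) ((one_le_div (by linarith)).2 h.le) (by nlinarith) (by field_simp)
    · have : clampK K x = -K := by
        unfold clampK
        rw [min_eq_left (by linarith), max_eq_right (by linarith)]
      rw [this]
      exact gen (-K) (-x / K) ((one_le_div (by linarith)).2 h.le) (by nlinarith) (by field_simp)

lemma hasDeriv_log {v : ℝ → ℝ} {v' t : ℝ} {S : Set ℝ} (h : HasDerivWithinAt v v' S t) :
    HasDerivWithinAt (fun s => Real.log (1 + v s ^ 2)) (2 * (v t * v') / (1 + v t ^ 2)) S t := by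
  have h0 : HasDerivWithinAt (fun s => 1 + v s ^ 2) (2 * v t ^ 1 * v') S t := by
    simpa using (h.fun_pow 2).const_add 1
  have h1 := h0.log (by positivity)
  convert h1 using 1
  ring

lemma exists_flow (t₀ T : ℝ) (hT : t₀ < T) (a b c d : ℝ → ℝ)
    (ha : ContinuousOn a (Icc t₀ T)) (hb : ContinuousOn b (Icc t₀ T))
    (hc : ContinuousOn c (Icc t₀ T)) (hd : ContinuousOn d (Icc t₀ T))
    (K R : ℝ) (hK : 1 ≤ K) (hR : 0 ≤ R) :
    ∃ α : ℝ → ℝ → ℝ, (∀ x ∈ Icc (-R) R, α x T = x ∧ ∀ t ∈ Icc t₀ T,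
      HasDerivWithinAt (α x) (-(a t * clampK K (α x t) ^ 3 + b t * clampK K (α x t) ^ 2
        + c t * clampK K (α x t) + d t)) (Icc t₀ T) t) ∧
      ContinuousOn (fun x => α x t₀) (Icc (-R) R) := by
  obtain ⟨A, hA⟩ := isCompact_Icc.exists_bound_of_continuousOn ha
  obtain ⟨B, hB⟩ := isCompact_Icc.exists_bound_of_continuousOn hb
  obtain ⟨C, hC⟩ := isCompact_Icc.exists_bound_of_continuousOn hc
  obtain ⟨D, hD⟩ := isCompact_Icc.exists_bound_of_continuousOn hd
  simp only [Real.norm_eq_abs] at hA hB hC hD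
  have ht : t₀ ∈ Icc t₀ T := ⟨le_rfl, hT.le⟩
  have hA0 : 0 ≤ A := (abs_nonneg _).trans (hA _ ht)
  have hB0 : 0 ≤ B := (abs_nonneg _).trans (hB _ ht)
  have hC0 : 0 ≤ C := (abs_nonneg _).trans (hC _ ht)
  have hD0 : 0 ≤ D := (abs_nonneg _).trans (hD _ ht)
  have hK0 : 0 ≤ K := by linarith
  have hL0 : 0 ≤ A * K ^ 3 + B * K ^ 2 + C * K + D := by positivity
  have hLip0 : 0 ≤ A * (3 * K ^ 2) + B * (2 * K) + C := by positivity
  have hT0 : 0 ≤ T - t₀ := by linarith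
  have hrad0 : 0 ≤ (A * K ^ 3 + B * K ^ 2 + C * K + D) * (T - t₀) + R := by positivity
  have hPL : IsPicardLindelof (fun t x => -(a t * clampK K x ^ 3 + b t * clampK K x ^ 2
        + c t * clampK K x + d t)) (tmin := t₀) (tmax := T) ⟨T, hT.le, le_rfl⟩ (0 : ℝ)
        ⟨_, hrad0⟩ ⟨R, hR⟩ ⟨_, hL0⟩ ⟨_, hLip0⟩ := by
    refine ⟨fun t ht => ?_, fun x _ => ?_, fun t ht x _ => ?_, ?_⟩
    · refine LipschitzOnWith.of_dist_le_mul fun x _ y _ => ?_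
      rw [Real.dist_eq, Real.dist_eq]
      change _ ≤ (A * (3 * K ^ 2) + B * (2 * K) + C) * |x - y|
      have hxy := clampK_lip K x y
      have hx := clampK_abs hK0 x
      have hy := clampK_abs hK0 y
      generalize clampK K x = p at *
      generalize clampK K y = q at *
      have e : -(a t * p ^ 3 + b t * p ^ 2 + c t * p + d t) -
          -(a t * q ^ 3 + b t * q ^ 2 + c t * q + d t) =
          -((a t * (p ^ 2 + p * q + q ^ 2) + b t * (p + q) + c t) * (p - q)) := by ring
      rw [e, abs_neg, abs_mul]
      have h1 : |p ^ 2 + p * q + q ^ 2| ≤ 3 * K ^ 2 := by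
        have h2 : |p ^ 2 + p * q + q ^ 2| ≤ |p| ^ 2 + |p| * |q| + |q| ^ 2 := by
          refine (abs_add_three _ _ _).trans ?_
          rw [abs_mul, abs_pow, abs_pow]
        have : |p| ^ 2 + |p| * |q| + |q| ^ 2 ≤ K ^ 2 + K * K + K ^ 2 := by gcongr
        nlinarith
      have h2 : |p + q| ≤ 2 * K := (abs_add_le _ _).trans (by linarith)
      refine mul_le_mul ?_ hxy (abs_nonneg _) hLip0
      refine (abs_add_three _ _ _).trans ?_
      rw [abs_mul, abs_mul]
      have := hA t ht
      have := hB t ht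
      have := hC t ht
      gcongr
    · exact (((ha.mul continuousOn_const).add (hb.mul continuousOn_const)).add
        (hc.mul continuousOn_const)).add hd |>.neg
    · rw [Real.norm_eq_abs, abs_neg]
      change _ ≤ A * K ^ 3 + B * K ^ 2 + C * K + D
      have hx := clampK_abs hK0 x
      generalize clampK K x = p at *
      refine (abs_add_le _ _).trans (add_le_add ((abs_add_three _ _ _).trans ?_) (hD t ht))
      rw [abs_mul, abs_mul, abs_mul, abs_pow, abs_pow]
      have := hA t ht
      have := hB t ht
      have := hC t ht
      gcongr
    · change (A * K ^ 3 + B * K ^ 2 + C * K + D) * max (T - T) (T - t₀) ≤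
        (A * K ^ 3 + B * K ^ 2 + C * K + D) * (T - t₀) + R - R
      rw [sub_self, max_eq_right hT0]
      linarith
  obtain ⟨α, h1, L', h2⟩ := hPL.exists_forall_mem_closedBall_eq_hasDerivWithinAt_lipschitzOnWith
  have hball : Metric.closedBall (0 : ℝ) R = Icc (-R) R := by
    rw [Real.closedBall_eq_Icc]; simp
  change ∀ x ∈ Metric.closedBall (0 : ℝ) R, _ at h1
  change ∀ t ∈ Icc t₀ T, LipschitzOnWith L' (fun x => α x t) (Metric.closedBall (0 : ℝ) R) at h2
  rw [hball] at h1 h2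
  exact ⟨α, h1, (h2 t₀ ht).continuousOn⟩

theorem abel_closed (t₀ T : ℝ) (hT : t₀ < T) (a b c d : ℝ → ℝ)
    (ha : ContinuousOn a (Icc t₀ T)) (hb : ContinuousOn b (Icc t₀ T))
    (hc : ContinuousOn c (Icc t₀ T)) (hd : ContinuousOn d (Icc t₀ T))
    (haneg : ∀ᵐ t ∂(volume.restrict (Icc t₀ T)), a t < 0)
    (hint : IntegrableOn (fun t => b t ^ 2 / a t) (Icc t₀ T)) :
    ∃ y : ℝ → ℝ, IsAbelSolOn a b c d y (Icc t₀ T) ∧ y t₀ = y T := by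
  set m : ℝ → ℝ := fun t => |b t ^ 2 / a t| + |c t| + |d t| with hm
  have hm0 : ∀ t, 0 ≤ m t := fun t => by simp only [hm]; positivity
  have hmint : IntegrableOn m (Icc t₀ T) :=
    (hint.abs.add hc.abs.integrableOn_Icc).add hd.abs.integrableOn_Icc
  have haint : IntegrableOn a (Icc t₀ T) := ha.integrableOn_Icc
  have ht₀ : t₀ ∈ Icc t₀ T := ⟨le_rfl, hT.le⟩
  have hTT : T ∈ Icc t₀ T := ⟨hT.le, le_rfl⟩
  set M : ℝ := ∫ t in t₀..T, m t with hM
  have hM0 : 0 ≤ M := intervalIntegral.integral_nonneg hT.le fun t _ => hm0 t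
  set A : ℝ := ∫ t in t₀..T, -a t with hA
  have hApos : 0 < A := by
    rw [hA, intervalIntegral.integral_of_le hT.le, ← integral_Icc_eq_integral_Ioc]
    have h0 : 0 ≤ᵐ[volume.restrict (Icc t₀ T)] fun t => -a t := by
      filter_upwards [haneg] with t h
      simp only [Pi.zero_apply]; linarith
    rw [integral_pos_iff_support_of_nonneg_ae h0 haint.neg]
    have : volume.restrict (Icc t₀ T) (Function.support fun t => -a t) =
        volume.restrict (Icc t₀ T) univ := by
      apply measure_congr
      filter_upwards [haneg] with t h
      apply propext
      change (-a t ≠ 0) ↔ True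
      simp [h.ne]
    rw [this]
    simp [hT]
  -- a priori bound for truncated solutions
  have bound : ∀ (K : ℝ) (v : ℝ → ℝ), 1 ≤ K → (∀ t ∈ Icc t₀ T,
      HasDerivWithinAt v (-(a t * clampK K (v t) ^ 3 + b t * clampK K (v t) ^ 2
        + c t * clampK K (v t) + d t)) (Icc t₀ T) t) →
      ∀ p q, t₀ ≤ p → p ≤ q → q ≤ T →
        Real.log (1 + v p ^ 2) ≤ Real.log (1 + v q ^ 2) + 2 * M := by
    intro K v hK hv p q hp hpq hq
    have hsub : Icc p q ⊆ Icc t₀ T := Icc_subset_Icc hp hq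
    have h := int_le_sub_ae hpq (φ := fun t => -(2 * m t))
      (fun t ht => hasDeriv_log ((hv t (hsub ht)).mono hsub))
      ((hmint.mono_set hsub).const_mul 2).neg (by
        filter_upwards [ae_restrict_of_ae_restrict_of_subset hsub haneg] with t h
        have := abel_pt_clamp (a t) (b t) (c t) (d t) (v t) K h hK
        rw [le_div_iff₀ (by positivity)]
        simp only [hm]
        linarith)
    rw [intervalIntegral.integral_neg, intervalIntegral.integral_const_mul] at h
    have h2 : ∫ t in p..q, m t ≤ M := by
      rw [hM]
      apply intervalIntegral.integral_mono_interval hp hpq hq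
      · exact Filter.Eventually.of_forall hm0
      · rw [intervalIntegrable_iff_integrableOn_Icc_of_le hT.le]; exact hmint
    linarith
  set S : ℝ := 2 + (2 * M + 1) / A with hS
  have hS2 : 2 ≤ S := by
    have : 0 ≤ (2 * M + 1) / A := by positivity
    linarith
  set R : ℝ := S * Real.exp (2 * M) with hRdef
  have hexp : 1 ≤ Real.exp (2 * M) := Real.one_le_exp (by linarith)
  have hR2 : 2 ≤ R := by nlinarith
  set K : ℝ := (1 + R ^ 2) * Real.exp (2 * M) with hKdef
  have hK1 : 1 ≤ K := by nlinarith [sq_nonneg R]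
  obtain ⟨α, hα, hcont⟩ := exists_flow t₀ T hT a b c d ha hb hc hd K R hK1 (by linarith)
  have small : ∀ x ∈ Icc (-R) R, ∀ t ∈ Icc t₀ T, |α x t| ≤ K := by
    intro x hx t ht
    have h := bound K (α x) hK1 (hα x hx).2 t T ht.1 ht.2 le_rfl
    rw [(hα x hx).1] at h
    have h1 : 1 + α x t ^ 2 ≤ (1 + x ^ 2) * Real.exp (2 * M) := by
      rw [← Real.log_le_log_iff (by positivity) (by positivity),
        Real.log_mul (by positivity) (by positivity), Real.log_exp]
      exact h
    have h2 : x ^ 2 ≤ R ^ 2 := sq_le_sq' hx.1 hx.2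
    have h3 : 1 + α x t ^ 2 ≤ K := h1.trans (by rw [hKdef]; gcongr)
    exact abs_le_of_sq_le_sq (by nlinarith) (by linarith)
  have sol : ∀ x ∈ Icc (-R) R, IsAbelSolOn a b c d (α x) (Icc t₀ T) := by
    intro x hx t ht
    have h := (hα x hx).2 t ht
    rw [clampK_eq (small x hx t ht)] at h
    exact h
  have maps : MapsTo (fun x => α x t₀) (Icc (-R) R) (Icc (-R) R) := by
    intro x hx
    by_contra hcon
    have hbig : R ^ 2 < α x t₀ ^ 2 := by
      by_contra h
      exact hcon (abs_le.1 (abs_le_of_sq_le_sq (not_lt.1 h) (by linarith)))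
    have hlow : ∀ t ∈ Icc t₀ T, S ≤ 1 + α x t ^ 2 := by
      intro t ht
      have h := bound K (α x) hK1 (hα x hx).2 t₀ t le_rfl ht.1 ht.2
      have h1 : 1 + α x t₀ ^ 2 ≤ (1 + α x t ^ 2) * Real.exp (2 * M) := by
        rw [← Real.log_le_log_iff (by positivity) (by positivity),
          Real.log_mul (by positivity) (by positivity), Real.log_exp]
        exact h
      have h2 : S * Real.exp (2 * M) ≤ (1 + α x t ^ 2) * Real.exp (2 * M) := by
        rw [← hRdef]; nlinarith
      exact le_of_mul_le_mul_right h2 (Real.exp_pos _)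
    have h := int_le_sub_ae hT.le (φ := fun t => (S - 2) * (-a t) - 2 * m t)
      (fun t ht => hasDeriv_log (sol x hx t ht))
      ((haint.neg.const_mul (S - 2)).sub (hmint.const_mul 2)) (by
        filter_upwards [haneg, ae_restrict_mem measurableSet_Icc] with t h ht
        have h1 := abel_pt (a t) (b t) (c t) (d t) (α x t) h
        have h2 := hlow t ht
        rw [le_div_iff₀ (by positivity)]
        simp only [hm, abelRHS]
        generalize |b t ^ 2 / a t| + |c t| + |d t| = μ at *
        have h3 : (S - 2) * (-a t) * (1 + α x t ^ 2) ≤ -a t * α x t ^ 4 := by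
          have : (S - 2) * (1 + α x t ^ 2) ≤ α x t ^ 4 := by
            have : (S - 2) * (1 + α x t ^ 2) ≤ (α x t ^ 2 - 1) * (1 + α x t ^ 2) := by
              exact mul_le_mul_of_nonneg_right (by linarith) (by positivity)
            nlinarith
          nlinarith
        nlinarith)
    rw [intervalIntegral.integral_sub, intervalIntegral.integral_const_mul,
      intervalIntegral.integral_const_mul, ← hM, ← hA, (hα x hx).1] at h
    · have h4 : (S - 2) * A = 2 * M + 1 := by rw [hS]; field_simp; ring
      have h5 : x ^ 2 ≤ R ^ 2 := sq_le_sq' hx.1 hx.2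
      have h6 : Real.log (1 + x ^ 2) ≤ Real.log (1 + α x t₀ ^ 2) :=
        Real.log_le_log (by positivity) (by linarith)
      linarith
    · rw [intervalIntegrable_iff_integrableOn_Icc_of_le hT.le]; exact haint.neg.const_mul _
    · rw [intervalIntegrable_iff_integrableOn_Icc_of_le hT.le]; exact hmint.const_mul _
  obtain ⟨x, hx, hfix⟩ := exists_mem_Icc_isFixedPt_of_mapsTo hcont (by linarith) maps
  exact ⟨α x, sol x hx, by rw [(hα x hx).1]; exact hfix⟩

/-- Theorem 5.5: existence of a closed solution of the Abel equation (1.1) on `[t₀, T]` by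
comparison with solutions `y₁` of (2.1) and `y₂` of (3.10), under `a < 0` a.e.,
integrability of `b²/a`, and the integral conditions (ii), (iii). -/
theorem stmt_15 (t₀ T : ℝ) (hT : t₀ < T)
    (a b c d a₁ b₁ c₁ d₁ a₂ b₂ c₂ d₂ y₁ y₂ : ℝ → ℝ)
    (ha : ContinuousOn a (Icc t₀ T)) (hb : ContinuousOn b (Icc t₀ T))
    (hc : ContinuousOn c (Icc t₀ T)) (hd : ContinuousOn d (Icc t₀ T))
    (ha₁ : ContinuousOn a₁ (Icc t₀ T)) (hb₁ : ContinuousOn b₁ (Icc t₀ T))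
    (hc₁ : ContinuousOn c₁ (Icc t₀ T)) (hd₁ : ContinuousOn d₁ (Icc t₀ T))
    (ha₂ : ContinuousOn a₂ (Icc t₀ T)) (hb₂ : ContinuousOn b₂ (Icc t₀ T))
    (hc₂ : ContinuousOn c₂ (Icc t₀ T)) (hd₂ : ContinuousOn d₂ (Icc t₀ T))
    (hy₁ : IsAbelSolOn a₁ b₁ c₁ d₁ y₁ (Icc t₀ T))
    (hy₂ : IsAbelSolOn a₂ b₂ c₂ d₂ y₂ (Icc t₀ T))
    (h12 : y₁ t₀ ≤ y₂ t₀) (h1T : y₁ t₀ ≤ y₁ T) (h2T : y₂ T ≤ y₂ t₀)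
    (haneg : ∀ᵐ t ∂(volume.restrict (Icc t₀ T)), a t < 0)
    (hint : IntegrableOn (fun t => b t ^ 2 / a t) (Icc t₀ T))
    (γ₁ : ℝ) (hγ₁ : γ₁ ∈ Icc (y₁ t₀) (y₂ t₀))
    (hii : ∀ t ∈ Icc t₀ T,
      0 ≤ γ₁ - y₁ t₀ + ∫ τ in t₀..t,
        Real.exp (∫ s in t₀..τ, (c s - b s ^ 2 / a s)) *
          ((a₁ τ - a τ) * y₁ τ ^ 3 + (b₁ τ - b τ) * y₁ τ ^ 2 +
            (c₁ τ - c τ) * y₁ τ + (d₁ τ - d τ)))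
    (γ₂ : ℝ) (hγ₂ : γ₂ ∈ Icc γ₁ (y₂ t₀))
    (hiii : ∀ t ∈ Icc t₀ T,
      γ₂ - y₂ t₀ + (∫ τ in t₀..t,
        Real.exp (∫ s in t₀..τ, (c s - b s ^ 2 / a s)) *
          ((a₂ τ - a τ) * y₂ τ ^ 3 + (b₂ τ - b τ) * y₂ τ ^ 2 +
            (c₂ τ - c τ) * y₂ τ + (d₂ τ - d τ))) ≤ 0) :
    ∃ y : ℝ → ℝ, IsAbelSolOn a b c d y (Icc t₀ T) ∧ y t₀ = y T := by
  exact abel_closed t₀ T hT a b c d ha hb hc hd haneg hint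
end
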